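/- arXiv:0912.0510 — 12 statements merged into one kernel-verified Lean document; each statement's English description precedes it below -/
import Mathlib

section
/- Let A, G₁, G₂ be groups, let α₁ : A → G₁ and α₂ : A → G₂ be injective group homomorphisms, and let H₁ ≤ G₁ and H₂ ≤ G₂ be subgroups such that α₁⁻¹(H₁) = α₂⁻¹(H₂); call this common subgroup B ≤ A. Then the canonical homomorphism from the amalgamated free product H₁ *_B H₂ (the pushout of the corestrictions of α₁ and α₂ to maps B → H₁ and B → H₂) to G₁ *_A G₂, induced by the subgroup inclusions H₁ ↪ G₁ and H₂ ↪ G₂, is injective. -/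
universe u

/-- `(P, κ₁, κ₂)` is a pushout (amalgamated free product) of the injective
homomorphisms `α₁ : A →* G₁` and `α₂ : A →* G₂` in the category of groups. -/
def IsAmalgamatedFreeProduct {A G₁ G₂ P : Type u} [Group A] [Group G₁] [Group G₂] [Group P]
    (α₁ : A →* G₁) (α₂ : A →* G₂) (κ₁ : G₁ →* P) (κ₂ : G₂ →* P) : Prop :=
  κ₁.comp α₁ = κ₂.comp α₂ ∧
    ∀ (Q : Type u) [Group Q] (f₁ : G₁ →* Q) (f₂ : G₂ →* Q),
      f₁.comp α₁ = f₂.comp α₂ → ∃! h : P →* Q, h.comp κ₁ = f₁ ∧ h.comp κ₂ = f₂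

namespace Monoid.PushoutI

open Function

section Map

variable {ι A B : Type*} {G K : ι → Type*} [Group A] [Group B] [∀ i, Group (G i)]
  [∀ i, Group (K i)] {φ : ∀ i, A →* G i} {ψ : ∀ i, B →* K i}

/-- The homomorphism between pushouts induced by a morphism of diagrams. -/
def map (θ : ∀ i, K i →* G i) (σ : B →* A) (hθ : ∀ i, (θ i).comp (ψ i) = (φ i).comp σ) :
    PushoutI ψ →* PushoutI φ :=
  lift (fun i => (of i).comp (θ i)) ((base φ).comp σ) fun i => by
    rw [MonoidHom.comp_assoc, hθ, ← MonoidHom.comp_assoc, of_comp_eq_base]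

theorem map_of (θ : ∀ i, K i →* G i) (σ : B →* A)
    (hθ : ∀ i, (θ i).comp (ψ i) = (φ i).comp σ) (i : ι) (k : K i) :
    map θ σ hθ (of i k) = of i (θ i k) := by
  simp [map]

/-- The image of a word under a family of injective homomorphisms, applied letterwise. -/
def mapWord (θ : ∀ i, K i →* G i) (hinj : ∀ i, Injective (θ i)) (w : CoprodI.Word K) :
    CoprodI.Word G where
  toList := w.toList.map (Sigma.map id fun i => θ i)
  ne_one := by
    intro l hl
    obtain ⟨k, hk, rfl⟩ := List.mem_map.1 hl
    exact (map_ne_one_iff (θ k.1) (hinj k.1)).2 (w.ne_one k hk)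
  chain_ne := by
    rw [List.isChain_map]
    exact w.chain_ne

theorem map_ofCoprodI_prod (θ : ∀ i, K i →* G i) (σ : B →* A)
    (hθ : ∀ i, (θ i).comp (ψ i) = (φ i).comp σ) (hinj : ∀ i, Injective (θ i))
    (w : CoprodI.Word K) :
    map θ σ hθ (ofCoprodI w.prod) = ofCoprodI (mapWord θ hinj w).prod := by
  simp only [CoprodI.Word.prod, mapWord, map, map_list_prod, List.map_map, Function.comp_def,
    Sigma.map, id, ofCoprodI_of, lift_of, MonoidHom.comp_apply]
  exact congrArg List.prod (List.map_congr_left fun k _ => (ofCoprodI_of k.1 (θ k.1 k.2)).symm)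

theorem NormalWord.reduced_toWord {d : NormalWord.Transversal ψ} (w : NormalWord d) :
    Reduced ψ w.toWord := by
  rintro ⟨i, g⟩ hg hr
  refine w.ne_one _ hg ?_
  have h₁ := ((d.compl i).coe_equiv_snd_eq_one_iff_mem (d.one_mem i)).2 hr
  rwa [((d.compl i).equiv_snd_eq_self_iff_mem (one_mem _)).2 (w.normalized i g hg)] at h₁

/-- A morphism of injective diagrams all of whose components are injective induces an injective
homomorphism of pushouts if it reflects membership in the amalgamated subgroup. -/
theorem map_injective (hφ : ∀ i, Injective (φ i)) (hψ : ∀ i, Injective (ψ i))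
    (θ : ∀ i, K i →* G i) (σ : B →* A) (hθ : ∀ i, (θ i).comp (ψ i) = (φ i).comp σ)
    (hinj : ∀ i, Injective (θ i)) (hσ : Injective σ)
    (hrange : ∀ i k, θ i k ∈ (φ i).range → k ∈ (ψ i).range) :
    Injective (map θ σ hθ) := by
  classical
  obtain ⟨d⟩ := NormalWord.transversal_nonempty ψ hψ
  rw [injective_iff_map_eq_one]
  intro x hx
  obtain ⟨w, rfl⟩ := (NormalWord.equiv (d := d)).symm.surjective x
  change map θ σ hθ (base ψ w.head * ofCoprodI w.toWord.prod) = 1 at hx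
  change base ψ w.head * ofCoprodI w.toWord.prod = 1
  have hbase : map θ σ hθ (base ψ w.head) = base φ (σ w.head) := by simp [map]
  rw [map_mul, hbase, map_ofCoprodI_prod θ σ hθ hinj] at hx
  have hred : Reduced φ (mapWord θ hinj w.toWord) := by
    intro g hg
    obtain ⟨k, hk, rfl⟩ := List.mem_map.1 hg
    exact fun h => w.reduced_toWord k hk (hrange k.1 k.2 h)
  have hnil : mapWord θ hinj w.toWord = .empty :=
    hred.eq_empty_of_mem_range hφ ⟨(σ w.head)⁻¹, by rw [map_inv, inv_eq_of_mul_eq_one_right hx]⟩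
  have hw : w.toWord = .empty := by
    ext1
    exact List.map_eq_nil_iff.1 (congrArg CoprodI.Word.toList hnil)
  rw [hnil, CoprodI.Word.prod_empty, map_one, mul_one] at hx
  have hhead : w.head = 1 :=
    hσ <| (base_injective hφ (hx.trans (map_one _).symm)).trans (map_one σ).symm
  rw [hw, hhead, CoprodI.Word.prod_empty, map_one, map_one, mul_one]

end Map

end Monoid.PushoutI

/-- The family of types indexed by `Bool` with members `X` at `true` and `Y` at `false`. -/
def BoolFamily (X Y : Type u) : Bool → Type u
  | true => X
  | false => Y

namespace BoolFamily

instance {X Y : Type u} [Group X] [Group Y] : ∀ i, Group (BoolFamily X Y i)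
  | true => inferInstanceAs (Group X)
  | false => inferInstanceAs (Group Y)

/-- A pair of homomorphisms with common source, as a family indexed by `Bool`. -/
def homs {A X Y : Type u} [Group A] [Group X] [Group Y] (f : A →* X) (g : A →* Y) :
    ∀ i, A →* BoolFamily X Y i
  | true => f
  | false => g

/-- A pair of homomorphisms with common target, as a family indexed by `Bool`. -/
def cohoms {Z X Y : Type u} [Group Z] [Group X] [Group Y] (f : X →* Z) (g : Y →* Z) :
    ∀ i, BoolFamily X Y i →* Z
  | true => f
  | false => g

/-- A pair of homomorphisms, as a family indexed by `Bool`. -/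
def mapHoms {X Y X' Y' : Type u} [Group X] [Group Y] [Group X'] [Group Y']
    (f : X →* X') (g : Y →* Y') : ∀ i, BoolFamily X Y i →* BoolFamily X' Y' i
  | true => f
  | false => g

variable {A X Y : Type u} [Group A] [Group X] [Group Y]

/-- The first canonical homomorphism into the concrete amalgamated product. -/
def inl (f : A →* X) (g : A →* Y) : X →* Monoid.PushoutI (homs f g) :=
  Monoid.PushoutI.of (φ := homs f g) true

/-- The second canonical homomorphism into the concrete amalgamated product. -/
def inr (f : A →* X) (g : A →* Y) : Y →* Monoid.PushoutI (homs f g) :=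
  Monoid.PushoutI.of (φ := homs f g) false

theorem inl_comp_eq_inr_comp (f : A →* X) (g : A →* Y) :
    (inl f g).comp f = (inr f g).comp g :=
  (Monoid.PushoutI.of_comp_eq_base (φ := homs f g) true).trans
    (Monoid.PushoutI.of_comp_eq_base (φ := homs f g) false).symm

end BoolFamily

namespace IsAmalgamatedFreeProduct

open BoolFamily

variable {A X Y P : Type u} [Group A] [Group X] [Group Y] [Group P]
  {f : A →* X} {g : A →* Y} {κ₁ : X →* P} {κ₂ : Y →* P}

theorem hom_ext (hP : IsAmalgamatedFreeProduct f g κ₁ κ₂) {R : Type u} [Group R]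
    {u v : P →* R} (h₁ : u.comp κ₁ = v.comp κ₁) (h₂ : u.comp κ₂ = v.comp κ₂) : u = v :=
  (hP.2 R (v.comp κ₁) (v.comp κ₂) (by
    rw [MonoidHom.comp_assoc, hP.1, MonoidHom.comp_assoc])).unique ⟨h₁, h₂⟩ ⟨rfl, rfl⟩

theorem exists_hom_pushoutI (hP : IsAmalgamatedFreeProduct f g κ₁ κ₂) :
    ∃ e : P →* Monoid.PushoutI (homs f g), e.comp κ₁ = inl f g ∧ e.comp κ₂ = inr f g :=
  (hP.2 _ _ _ (inl_comp_eq_inr_comp f g)).exists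

theorem injective_of_comp_eq (hP : IsAmalgamatedFreeProduct f g κ₁ κ₂)
    {e : P →* Monoid.PushoutI (homs f g)} (he₁ : e.comp κ₁ = inl f g)
    (he₂ : e.comp κ₂ = inr f g) : Function.Injective e := by
  have hc : ∀ i, (cohoms κ₁ κ₂ i).comp (homs f g i) = κ₁.comp f := by
    rintro (_ | _)
    · exact hP.1.symm
    · rfl
  let r : Monoid.PushoutI (homs f g) →* P := Monoid.PushoutI.lift (cohoms κ₁ κ₂) (κ₁.comp f) hc
  have hr : r.comp e = MonoidHom.id P := by
    apply hP.hom_ext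
    · rw [MonoidHom.comp_assoc, he₁]
      exact MonoidHom.ext fun x =>
        Monoid.PushoutI.lift_of (i := true) (cohoms κ₁ κ₂) (κ₁.comp f) hc x
    · rw [MonoidHom.comp_assoc, he₂]
      exact MonoidHom.ext fun x =>
        Monoid.PushoutI.lift_of (i := false) (cohoms κ₁ κ₂) (κ₁.comp f) hc x
  exact Function.LeftInverse.injective (g := r) (DFunLike.congr_fun hr)

end IsAmalgamatedFreeProduct

/-- If `H₁ ≤ G₁`, `H₂ ≤ G₂` pull back to the same subgroup `B ≤ A`, then the canonical
homomorphism `H₁ *_B H₂ →* G₁ *_A G₂` induced by the inclusions is injective. -/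
theorem amalgam_inclusion_injective {A G₁ G₂ : Type u} [Group A] [Group G₁] [Group G₂]
    (α₁ : A →* G₁) (α₂ : A →* G₂)
    (hα₁ : Function.Injective α₁) (hα₂ : Function.Injective α₂)
    (H₁ : Subgroup G₁) (H₂ : Subgroup G₂)
    (hB : Subgroup.comap α₁ H₁ = Subgroup.comap α₂ H₂)
    -- the corestrictions of `α₁`, `α₂` to maps `B → H₁` and `B → H₂`,
    -- where `B` is the common preimage subgroup:
    (β₁ : ↥(Subgroup.comap α₁ H₁) →* ↥H₁) (β₂ : ↥(Subgroup.comap α₁ H₁) →* ↥H₂)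
    (hβ₁ : ∀ b, (β₁ b : G₁) = α₁ b) (hβ₂ : ∀ b, (β₂ b : G₂) = α₂ b)
    {Q P : Type u} [Group Q] [Group P]
    (lam₁ : ↥H₁ →* Q) (lam₂ : ↥H₂ →* Q)
    (hQ : IsAmalgamatedFreeProduct β₁ β₂ lam₁ lam₂)
    (κ₁ : G₁ →* P) (κ₂ : G₂ →* P)
    (hP : IsAmalgamatedFreeProduct α₁ α₂ κ₁ κ₂)
    -- the canonical homomorphism induced by the subgroup inclusions:
    (h : Q →* P)
    (hh₁ : h.comp lam₁ = κ₁.comp H₁.subtype)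
    (hh₂ : h.comp lam₂ = κ₂.comp H₂.subtype) :
    Function.Injective h := by
  obtain ⟨e, he₁, he₂⟩ := hQ.exists_hom_pushoutI
  obtain ⟨p, hp₁, hp₂⟩ := hP.exists_hom_pushoutI
  have hθ : ∀ i, (BoolFamily.mapHoms H₁.subtype H₂.subtype i).comp (BoolFamily.homs β₁ β₂ i) =
      (BoolFamily.homs α₁ α₂ i).comp (Subgroup.comap α₁ H₁).subtype := by
    rintro (_ | _)
    · exact MonoidHom.ext hβ₂
    · exact MonoidHom.ext hβ₁
  have hφ : ∀ i, Function.Injective (BoolFamily.homs α₁ α₂ i) := by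
    rintro (_ | _)
    · exact hα₂
    · exact hα₁
  have hψ : ∀ i, Function.Injective (BoolFamily.homs β₁ β₂ i) := by
    rintro (_ | _)
    · intro a b hab
      exact Subtype.ext (hα₂ (by rw [← hβ₂, ← hβ₂]; exact congrArg Subtype.val hab))
    · intro a b hab
      exact Subtype.ext (hα₁ (by rw [← hβ₁, ← hβ₁]; exact congrArg Subtype.val hab))
  have hinj : ∀ i, Function.Injective (BoolFamily.mapHoms H₁.subtype H₂.subtype i) := by
    rintro (_ | _)
    · exact H₂.subtype_injective
    · exact H₁.subtype_injective
  have hrange : ∀ i k, BoolFamily.mapHoms H₁.subtype H₂.subtype i k ∈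
      (BoolFamily.homs α₁ α₂ i).range → k ∈ (BoolFamily.homs β₁ β₂ i).range := by
    rintro (_ | _) k ⟨a, ha⟩
    · replace ha : α₂ a = H₂.subtype k := ha
      have hmem : a ∈ Subgroup.comap α₁ H₁ := by
        rw [hB, Subgroup.mem_comap, ha]
        exact Subtype.property (p := (· ∈ H₂)) k
      exact ⟨⟨a, hmem⟩, Subtype.ext ((hβ₂ ⟨a, hmem⟩).trans ha)⟩
    · replace ha : α₁ a = H₁.subtype k := ha
      have hmem : a ∈ Subgroup.comap α₁ H₁ := by
        rw [Subgroup.mem_comap, ha]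
        exact Subtype.property (p := (· ∈ H₁)) k
      exact ⟨⟨a, hmem⟩, Subtype.ext ((hβ₁ ⟨a, hmem⟩).trans ha)⟩
  have hm := Monoid.PushoutI.map_injective hφ hψ _ _ hθ hinj
    (Subgroup.subtype_injective _) hrange
  have hcomm : p.comp h = (Monoid.PushoutI.map _ _ hθ).comp e := by
    apply hQ.hom_ext
    · rw [MonoidHom.comp_assoc, hh₁, ← MonoidHom.comp_assoc, hp₁, MonoidHom.comp_assoc, he₁]
      exact MonoidHom.ext fun x => (Monoid.PushoutI.map_of _ _ hθ true x).symm
    · rw [MonoidHom.comp_assoc, hh₂, ← MonoidHom.comp_assoc, hp₂, MonoidHom.comp_assoc, he₂]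
      exact MonoidHom.ext fun x => (Monoid.PushoutI.map_of _ _ hθ false x).symm
  have hcomp : Function.Injective (p.comp h) := by
    rw [hcomm]
    exact hm.comp (hQ.injective_of_comp_eq he₁ he₂)
  exact Function.Injective.of_comp (f := p) hcomp
end

section
/- Let C be a group, I a set, and for each i ∈ I let A_i ≤ C be a subgroup, B_i a group, and φ_i : A_i → B_i an injective group homomorphism. Let G be the colimit, in the category of groups, of the star-shaped diagram whose objects are C, the groups A_i and the groups B_i, with morphisms the subgroup inclusions A_i ↪ C and the maps φ_i : A_i → B_i; write κ_C : C → G and κ_i : B_i → G for the canonical homomorphisms. If H_i ≤ B_i are subgroups such that H_i ∩ φ_i(A_i) is trivial for every i ∈ I, then the homomorphism h from the free product ⋆_{i∈I} H_i to G induced by the composites H_i ↪ B_i → G is injective, and the image of h intersects κ_C(C) trivially. -/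
universe u

/-- `(G, κC, κ)` is a colimit, in the category of groups, of the star-shaped diagram
with central vertex group `C`, edge groups `A i ≤ C` and outer vertex groups `B i`,
whose morphisms are the inclusions `A i ↪ C` and the monomorphisms `φ i : A i →* B i`. -/
def IsStarColimit {C : Type u} [Group C] {I : Type u} (A : I → Subgroup C)
    {B : I → Type u} [∀ i, Group (B i)] (φ : ∀ i, ↥(A i) →* B i)
    {G : Type u} [Group G] (κC : C →* G) (κ : ∀ i, B i →* G) : Prop :=
  (∀ i, (κ i).comp (φ i) = κC.comp (A i).subtype) ∧
    ∀ (H : Type u) [Group H] (fC : C →* H) (f : ∀ i, B i →* H),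
      (∀ i, (f i).comp (φ i) = fC.comp (A i).subtype) →
      ∃! h : G →* H, h.comp κC = fC ∧ ∀ i, h.comp (κ i) = f i

/-- Two groups `B` and `C` with a common subgroup `A` embed compatibly in a third group, in which
every element of `B` lying in `C` already lies in `A`. -/
theorem exists_amalgam {A B C : Type u} [Group A] [Group B] [Group C]
    (φ : A →* B) (ψ : A →* C) (hφ : Function.Injective φ) (hψ : Function.Injective ψ) :
    ∃ (D : Type u) (_ : Group D) (β : B →* D) (γ : C →* D),
      β.comp φ = γ.comp ψ ∧ Function.Injective γ ∧ ∀ b, β b ∈ γ.range → b ∈ φ.range := by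
  -- Embedding both factors in `B × C` avoids a dependent family over `Bool`.
  let χ : Bool → A →* B × C := fun s =>
    if s then (MonoidHom.inl B C).comp φ else (MonoidHom.inr B C).comp ψ
  have hχ : ∀ s, Function.Injective (χ s) := by
    rintro (_ | _) x y h
    · exact hψ (by simpa [χ] using h)
    · exact hφ (by simpa [χ] using h)
  have htrue (a : A) : Monoid.PushoutI.of true (φ a, 1) = Monoid.PushoutI.base χ a :=
    Monoid.PushoutI.of_apply_eq_base χ true a
  have hfalse (a : A) : Monoid.PushoutI.of false (1, ψ a) = Monoid.PushoutI.base χ a :=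
    Monoid.PushoutI.of_apply_eq_base χ false a
  refine ⟨Monoid.PushoutI χ, inferInstance,
    (Monoid.PushoutI.of (φ := χ) true).comp (MonoidHom.inl B C),
    (Monoid.PushoutI.of (φ := χ) false).comp (MonoidHom.inr B C), ?_, ?_, ?_⟩
  · ext a
    exact (htrue a).trans (hfalse a).symm
  · exact (Monoid.PushoutI.of_injective hχ false).comp (Prod.mk_right_injective 1)
  · rintro b ⟨c, hc⟩
    have hb : Monoid.PushoutI.of (φ := χ) true (b, 1) ∈ (Monoid.PushoutI.base χ).range := by
      rw [← Monoid.PushoutI.inf_of_range_eq_base_range hχ (i := true) (j := false) (by simp)]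
      exact ⟨⟨_, rfl⟩, ⟨_, hc⟩⟩
    obtain ⟨a, ha⟩ := hb
    rw [← htrue] at ha
    exact ⟨a, congrArg Prod.fst (Monoid.PushoutI.of_injective hχ true ha)⟩

/-- An element of a free product which is mapped into the base group of an amalgamated product by
factorwise homomorphisms sending no nontrivial element to the base group is trivial. -/
theorem eq_one_of_lift_mem_base_range {I C : Type*} {D K : I → Type*} [Group C]
    [∀ i, Group (D i)] [∀ i, Group (K i)] (γ : ∀ i, C →* D i)
    (hγ : ∀ i, Function.Injective (γ i)) (f : ∀ i, K i →* D i)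
    (hf : ∀ i k, f i k ∈ (γ i).range → k = 1) (x : Monoid.CoprodI K)
    (hx : Monoid.CoprodI.lift (fun i => (Monoid.PushoutI.of (φ := γ) i).comp (f i)) x ∈
      (Monoid.PushoutI.base γ).range) :
    x = 1 := by
  classical
  obtain ⟨w, rfl⟩ := Monoid.CoprodI.Word.equiv.symm.surjective x
  change Monoid.CoprodI.lift _ w.prod ∈ _ at hx
  let v : Monoid.CoprodI.Word D :=
    { toList := w.toList.map fun p => ⟨p.1, f p.1 p.2⟩
      ne_one := by
        intro l hl h
        obtain ⟨p, hp, rfl⟩ := List.mem_map.1 hl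
        exact w.ne_one p hp (hf _ _ ((show f p.1 p.2 = 1 from h) ▸ one_mem _))
      chain_ne := (List.isChain_map _).2 w.chain_ne }
  have hv : Monoid.PushoutI.Reduced γ v := by
    intro g hg h
    obtain ⟨p, hp, rfl⟩ := List.mem_map.1 hg
    exact w.ne_one p hp (hf _ _ h)
  have hprod : Monoid.PushoutI.ofCoprodI v.prod =
      Monoid.CoprodI.lift (fun i => (Monoid.PushoutI.of (φ := γ) i).comp (f i)) w.prod := by
    simp [v, Monoid.CoprodI.Word.prod, map_list_prod, Function.comp_def]
  have hempty := hv.eq_empty_of_mem_range hγ (hprod ▸ hx)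
  have hw : w = .empty :=
    Monoid.CoprodI.Word.ext (List.map_eq_nil_iff.1 (congrArg (·.toList) hempty))
  subst hw
  exact Monoid.CoprodI.Word.prod_empty

/-- If `H i ≤ B i` are subgroups with `H i ∩ φ i (A i)` trivial, then the induced
homomorphism from the free product `⋆_{i} H i` to the colimit `G` is injective and its
image intersects the image of the central vertex group `C` trivially. -/
theorem freeProduct_into_starColimit_injective {C : Type u} [Group C] {I : Type u}
    (A : I → Subgroup C)
    {B : I → Type u} [∀ i, Group (B i)] (φ : ∀ i, ↥(A i) →* B i)
    (hφ : ∀ i, Function.Injective (φ i))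
    {G : Type u} [Group G] (κC : C →* G) (κ : ∀ i, B i →* G)
    (hG : IsStarColimit A φ κC κ)
    (H : ∀ i, Subgroup (B i))
    (hH : ∀ i, H i ⊓ (φ i).range = ⊥) :
    Function.Injective
        (Monoid.CoprodI.lift (fun i => (κ i).comp (H i).subtype) :
          Monoid.CoprodI (fun i => ↥(H i)) →* G) ∧
      (Monoid.CoprodI.lift (fun i => (κ i).comp (H i).subtype) :
          Monoid.CoprodI (fun i => ↥(H i)) →* G).range ⊓ κC.range = ⊥ := by
  choose D instD β γ hcomm hγ hβ using fun i =>
    exists_amalgam (φ i) (A i).subtype (hφ i) (A i).subtype_injective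
  obtain ⟨p, ⟨hpC, hp⟩, -⟩ := hG.2 (Monoid.PushoutI γ) (Monoid.PushoutI.base γ)
    (fun i => (Monoid.PushoutI.of i).comp (β i)) fun i => by
      rw [MonoidHom.comp_assoc, hcomm, ← MonoidHom.comp_assoc, Monoid.PushoutI.of_comp_eq_base]
  have hcomp : p.comp (Monoid.CoprodI.lift fun i => (κ i).comp (H i).subtype) =
      Monoid.CoprodI.lift fun i =>
        (Monoid.PushoutI.of (φ := γ) i).comp ((β i).comp (H i).subtype) := by
    ext i x
    simpa using DFunLike.congr_fun (hp i) (x : B i)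
  have key (x : Monoid.CoprodI fun i => ↥(H i))
      (hx : Monoid.CoprodI.lift (fun i => (κ i).comp (H i).subtype) x ∈ κC.range) : x = 1 := by
    refine eq_one_of_lift_mem_base_range γ hγ (fun i => (β i).comp (H i).subtype)
      (fun i k hk => ?_) x ?_
    · have hmem : (k : B i) ∈ H i ⊓ (φ i).range := ⟨k.2, hβ i k hk⟩
      rw [hH i, Subgroup.mem_bot] at hmem
      exact Subtype.ext hmem
    · obtain ⟨c, hc⟩ := hx
      rw [← hcomp, MonoidHom.comp_apply, ← hc, ← hpC]
      exact ⟨c, rfl⟩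
  constructor
  · exact (injective_iff_map_eq_one _).2 fun x hx => key x (hx ▸ one_mem _)
  · rw [eq_bot_iff]
    rintro _ ⟨⟨x, rfl⟩, hx⟩
    rw [key x hx, map_one]
    exact one_mem _
end

section
/- Let C be a group, I a set, and for each i ∈ I let A_i ≤ C be a subgroup, B_i a group, and φ_i : A_i → B_i an injective group homomorphism. Let G be the colimit, in the category of groups, of the star-shaped diagram whose objects are C, the groups A_i and the groups B_i, with morphisms the subgroup inclusions A_i ↪ C and the maps φ_i : A_i → B_i. Then the canonical homomorphism κ_C : C → G and each canonical homomorphism κ_i : B_i → G are injective. -/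
universe u

open Monoid in
/-- Two injective homomorphisms out of a group `A` can be amalgamated: their targets embed into
a common group in such a way that the two images of `A` agree pointwise. -/
theorem exists_injective_amalgam {A B C : Type u} [Group A] [hB : Group B] [hC : Group C]
    (φ : A →* B) (ψ : A →* C) (hφ : Function.Injective φ) (hψ : Function.Injective ψ) :
    ∃ (P : Type u) (_ : Group P) (f : B →* P) (g : C →* P),
      f.comp φ = g.comp ψ ∧ Function.Injective f ∧ Function.Injective g := by
  have key (X : Bool → Type u) [∀ b, Group (X b)] (χ : ∀ b, A →* X b)
      (hχ : ∀ b, Function.Injective (χ b)) :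
      ∃ (P : Type u) (_ : Group P) (f : X false →* P) (g : X true →* P),
        f.comp (χ false) = g.comp (χ true) ∧ Function.Injective f ∧ Function.Injective g :=
    ⟨PushoutI χ, inferInstance, PushoutI.of false, PushoutI.of true,
      (PushoutI.of_comp_eq_base false).trans (PushoutI.of_comp_eq_base true).symm,
      PushoutI.of_injective hχ false, PushoutI.of_injective hχ true⟩
  exact @key (fun b => Bool.rec B C b) (fun b => Bool.rec hB hC b) (fun b => Bool.rec φ ψ b)
    (fun b => Bool.rec hφ hψ b)

/-- Every vertex group of a star-shaped tree of groups embeds into the colimit: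
the canonical homomorphisms `κC : C →* G` and `κ i : B i →* G` are injective. -/
theorem starColimit_vertex_groups_embed {C : Type u} [Group C] {I : Type u}
    (A : I → Subgroup C)
    {B : I → Type u} [∀ i, Group (B i)] (φ : ∀ i, ↥(A i) →* B i)
    (hφ : ∀ i, Function.Injective (φ i))
    {G : Type u} [Group G] (κC : C →* G) (κ : ∀ i, B i →* G)
    (hG : IsStarColimit A φ κC κ) :
    Function.Injective κC ∧ ∀ i, Function.Injective (κ i) := by
  choose P instP f g hfg hf hg using fun i =>
    exists_injective_amalgam (φ i) (A i).subtype (hφ i) (A i).subtype_injective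
  obtain ⟨h, ⟨hC, hB⟩, -⟩ := hG.2 (Monoid.PushoutI g) (Monoid.PushoutI.base g)
    (fun i => (Monoid.PushoutI.of i).comp (f i)) fun i => by
      rw [MonoidHom.comp_assoc, hfg, ← MonoidHom.comp_assoc, Monoid.PushoutI.of_comp_eq_base]
  refine ⟨.of_comp (f := h) ?_, fun i => .of_comp (f := h) ?_⟩
  · rw [← MonoidHom.coe_comp, hC]
    exact Monoid.PushoutI.base_injective hg
  · rw [← MonoidHom.coe_comp, hB, MonoidHom.coe_comp]
    exact (Monoid.PushoutI.of_injective hg i).comp (hf i)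
end

section
/- Let A, G₁, G₂ be groups and α₁ : A → G₁, α₂ : A → G₂ injective group homomorphisms, and let P = G₁ *_A G₂ with canonical homomorphisms κ₁ : G₁ → P and κ₂ : G₂ → P. Then every finite subgroup H ≤ P is conjugate in P to a subgroup of κ₁(G₁) or to a subgroup of κ₂(G₂); that is, there exists g ∈ P with g H g⁻¹ ⊆ κ₁(G₁) or g H g⁻¹ ⊆ κ₂(G₂). -/
universe u

namespace Monoid.PushoutI

open Function CoprodI

variable {ι : Type*} {G : ι → Type*} {A : Type*} [∀ i, Group (G i)] [Group A]
  {φ : ∀ i, A →* G i}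

namespace NormalWord

variable [DecidableEq ι] [∀ i, DecidableEq (G i)] {d : Transversal φ}

/-- The length of a normal word after removing its first letter when that letter lies in `G i`.
This is the distance, in the Bass-Serre tree, from the base edge to a vertex of type `i`. -/
noncomputable def depth (i : ι) (w : NormalWord d) : ℕ :=
  (equivPair i w).tail.toList.length

theorem depth_summand_smul {i : ι} (g : G i) (w : NormalWord d) :
    depth i (g • w) = depth i w := by
  simp [depth, summand_smul_def']

theorem length_rcons {i : ι} (p : Pair d i) :
    (rcons i p).toList.length =
      p.tail.toList.length + if (rcons i p).fstIdx = some i then 1 else 0 := by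
  simp only [rcons, Word.equivPair_symm, Word.rcons]
  split_ifs with h₁ h₂ h₂
  · exact absurd h₂ p.fstIdx_ne
  · rfl
  · simp [Word.cons]
  · simp at h₂

theorem length_eq_depth_add (i : ι) (w : NormalWord d) :
    w.toList.length = depth i w + if w.fstIdx = some i then 1 else 0 := by
  have h := length_rcons (equivPair i w)
  have hw : rcons i (equivPair i w) = w := (equivPair i).symm_apply_apply w
  rwa [hw] at h

theorem depth_lt_depth_smul {i j k : ι} (hij : i ≠ j) (hkj : k ≠ j) (w : NormalWord d)
    (h : depth i w ≤ depth j w) {g : G j} (hg : g ∉ (φ j).range) :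
    depth j w < depth k (g • w) := by
  have hi := length_eq_depth_add i w
  have hj := length_eq_depth_add j w
  have hw : w.fstIdx ≠ some j := by
    intro hw
    have hne : w.fstIdx ≠ some i := by
      rw [hw]
      simpa using hij.symm
    rw [if_neg hne] at hi
    rw [if_pos hw] at hj
    omega
  have hcons : cons g w hw hg = g • w := by rw [cons_eq_smul, of_smul_eq_smul]
  rw [← hcons]
  have hk := length_eq_depth_add k (cons g w hw hg)
  have hfst : (cons g w hw hg).fstIdx = some j := by simp [Word.fstIdx]
  rw [hfst, if_neg (by simpa using hkj.symm)] at hk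
  rw [if_neg hw] at hj
  simp only [cons_toList, List.length_cons] at hk
  omega

end NormalWord

/-- A family of functions on the vertices `x G i` of the Bass-Serre tree behaving like the distance
from a base edge: once it fails to decrease along a path without backtracking, it increases. -/
theorem exists_depth (hφ : ∀ i, Injective (φ i)) :
    ∃ D : ι → PushoutI φ → ℕ, (∀ i x (g : G i), D i (x * of i g) = D i x) ∧
      ∀ i j k x (g : G j), i ≠ j → k ≠ j → D i x ≤ D j x → g ∉ (φ j).range →
        D j x < D k (x * of j g) := by
  classical
  obtain ⟨d⟩ := NormalWord.transversal_nonempty φ hφ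
  refine ⟨fun i x => NormalWord.depth i (x⁻¹ • (NormalWord.empty : NormalWord d)), ?_, ?_⟩
  · intro i x g
    beta_reduce
    rw [mul_inv_rev, mul_smul, ← map_inv, NormalWord.of_smul_eq_smul,
      NormalWord.depth_summand_smul]
  · intro i j k x g hij hkj h hg
    beta_reduce
    rw [mul_inv_rev, mul_smul, ← map_inv, NormalWord.of_smul_eq_smul]
    exact NormalWord.depth_lt_depth_smul hij hkj _ h (by rwa [inv_mem_iff])

theorem exists_eq_of_mul_reduced (hφ : ∀ i, Injective (φ i)) (i : ι) (y : PushoutI φ) :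
    ∃ (g : G i) (w : Word G), w.fstIdx ≠ some i ∧ Reduced φ w ∧
      y = of i g * ofCoprodI w.prod := by
  classical
  obtain ⟨d⟩ := NormalWord.transversal_nonempty φ hφ
  obtain ⟨v, rfl⟩ := (NormalWord.equiv (d := d)).symm.surjective y
  obtain ⟨p, rfl⟩ := (NormalWord.equivPair i).symm.surjective v
  refine ⟨p.head, p.tail, p.fstIdx_ne, ?_, ?_⟩
  · rintro ⟨j, g⟩ hg hmem
    rw [← SetLike.mem_coe, ← (d.compl j).coe_equiv_snd_eq_one_iff_mem (d.one_mem j),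
      ((d.compl j).equiv_snd_eq_self_iff_mem (one_mem _)).2 (p.normalized j g hg)] at hmem
    exact p.tail.ne_one _ hg hmem
  · change (NormalWord.rcons i p).prod = _
    simp only [NormalWord.prod, NormalWord.rcons, Word.equivPair_symm, Word.prod_rcons, map_mul,
      ofCoprodI_of, ← of_apply_eq_base φ i, MonoidHom.apply_ofInjective_symm, ← mul_assoc]
    rw [← map_mul, (d.compl i).equiv_fst_mul_equiv_snd]

/-- A function as in `exists_depth` keeps growing along reduced words. -/
theorem Reduced.le_depth {D : ι → PushoutI φ → ℕ}
    (hD : ∀ i x (g : G i), D i (x * of i g) = D i x)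
    (hlt : ∀ i j k x (g : G j), i ≠ j → k ≠ j → D i x ≤ D j x → g ∉ (φ j).range →
      D j x < D k (x * of j g))
    {w : Word G} (hw : Reduced φ w) {j : ι} (hj : w.fstIdx ≠ some j) {z : PushoutI φ}
    (hz : ∀ k ≠ j, D j z < D k z) (i : ι) :
    D j z ≤ D i (z * ofCoprodI w.prod) ∧ (i ≠ j → D j z < D i (z * ofCoprodI w.prod)) := by
  classical
  induction w using Word.consRecOn generalizing j z with
  | empty =>
    rcases eq_or_ne i j with rfl | h
    · simp
    · simpa [h] using ⟨(hz i h).le, hz i h⟩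
  | cons k g w hk hg ih =>
    have hkj : k ≠ j := by simpa using hj
    have hgr : g ∉ (φ k).range := hw ⟨k, g⟩ List.mem_cons_self
    have h := (ih (fun l hl => hw l (List.mem_cons_of_mem _ hl)) hk
      (z := z * of k g) fun l hl => by
        rw [hD]
        exact hlt j k l z g hkj.symm hl (hz k hkj).le hgr).1
    rw [hD, mul_assoc] at h
    rw [Word.prod_cons, map_mul, ofCoprodI_of]
    have := (hz k hkj).trans_le h
    exact ⟨this.le, fun _ => this⟩

/-- Every finite subgroup of an amalgamated product is conjugate into one of the factors. -/
theorem exists_conj_mem_range_of_finite [Nonempty ι] (hφ : ∀ i, Injective (φ i))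
    (H : Subgroup (PushoutI φ)) [Finite H] :
    ∃ (g : PushoutI φ) (i : ι), ∀ x ∈ H, g * x * g⁻¹ ∈ (of (φ := φ) i).range := by
  classical
  obtain ⟨D, hD, hlt⟩ := exists_depth hφ
  have := Fintype.ofFinite H
  let f : ι × PushoutI φ → ℕ := fun v => Finset.univ.sup fun h : H => D v.1 ((h : PushoutI φ) * v.2)
  obtain ⟨⟨i, x⟩, hmin⟩ : ∃ v, ∀ v', f v ≤ f v' :=
    ⟨argmin f, fun v' => argmin_le f v'⟩
  refine ⟨x⁻¹, i, fun h hh => ?_⟩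
  obtain ⟨g, w, hwi, hw, hy⟩ := exists_eq_of_mul_reduced hφ i (x⁻¹ * h * x⁻¹⁻¹)
  rw [hy]
  induction w using Word.consRecOn with
  | empty => simp
  | cons j t w hj ht _ =>
    exfalso
    have hji : j ≠ i := by simpa using hwi
    have htr : t ∉ (φ j).range := hw ⟨j, t⟩ List.mem_cons_self
    obtain ⟨k, -, hk⟩ := Finset.exists_mem_eq_sup (Finset.univ : Finset H) ⟨1, Finset.mem_univ _⟩
      fun h : H => D j ((h : PushoutI φ) * (x * of i g))
    have hle : ∀ l : H, D i ((l : PushoutI φ) * x) ≤ D j ((k : PushoutI φ) * (x * of i g)) := fun l =>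
      (Finset.le_sup (f := fun h : H => D i ((h : PushoutI φ) * x)) (Finset.mem_univ l)).trans
        ((hmin (j, x * of i g)).trans_eq hk)
    have hz := hle k
    rw [← hD i _ g, mul_assoc] at hz
    have hlast := (Reduced.le_depth hD hlt (fun l hl => hw l (List.mem_cons_of_mem _ hl)) hj
      (z := (k : PushoutI φ) * (x * of i g) * of j t)
      (fun l hl => by
        rw [hD]
        exact hlt i j l _ t hji.symm hl hz htr) i).2 hji.symm
    have heq : (k : PushoutI φ) * (x * of i g) * of j t * ofCoprodI w.prod
        = ((k * ⟨h, hh⟩ : H) : PushoutI φ) * x := by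
      rw [Word.prod_cons, map_mul, ofCoprodI_of] at hy
      simp only [Subgroup.coe_mul, mul_assoc] at hy ⊢
      rw [← hy]
      simp
    rw [hD, heq] at hlast
    exact absurd (hle _) hlast.not_ge

end Monoid.PushoutI

/-- A finite subgroup of an amalgamated free product, with the two factors given as a family
indexed by `Bool`, is conjugate into one of the factors. -/
theorem exists_conj_mem_range_of_isAmalgamatedFreeProduct {A P : Type u} {G : Bool → Type u}
    [Group A] [Group P] [∀ b, Group (G b)] (φ : ∀ b, A →* G b)
    (hφ : ∀ b, Function.Injective (φ b)) (κ : ∀ b, G b →* P)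
    (hP : IsAmalgamatedFreeProduct (φ true) (φ false) (κ true) (κ false))
    (H : Subgroup P) [Finite H] :
    ∃ (g : P) (b : Bool), ∀ x ∈ H, g * x * g⁻¹ ∈ (κ b).range := by
  let k : Monoid.PushoutI φ →* P :=
    Monoid.PushoutI.lift κ ((κ true).comp (φ true)) (Bool.rec hP.1.symm rfl)
  have hk : ∀ b (g : G b), k (Monoid.PushoutI.of b g) = κ b g := fun b g =>
    Monoid.PushoutI.lift_of _ _ _ g
  obtain ⟨f, ⟨hf₁, hf₂⟩, -⟩ := hP.2 (Monoid.PushoutI φ)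
    (Monoid.PushoutI.of (φ := φ) true) (Monoid.PushoutI.of (φ := φ) false)
    ((Monoid.PushoutI.of_comp_eq_base (φ := φ) true).trans
      (Monoid.PushoutI.of_comp_eq_base (φ := φ) false).symm)
  have hkf : k.comp f = MonoidHom.id P := by
    refine (hP.2 P (κ true) (κ false) hP.1).unique ⟨?_, ?_⟩ ⟨rfl, rfl⟩
    · rw [MonoidHom.comp_assoc, hf₁]
      exact MonoidHom.ext (hk true)
    · rw [MonoidHom.comp_assoc, hf₂]
      exact MonoidHom.ext (hk false)
  have : Finite (H.map f) := inferInstanceAs (Finite (f '' H))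
  obtain ⟨g, b, hg⟩ := Monoid.PushoutI.exists_conj_mem_range_of_finite hφ (H.map f)
  refine ⟨k g, b, fun x hx => ?_⟩
  obtain ⟨y, hy⟩ := hg (f x) (Subgroup.mem_map_of_mem f hx)
  refine ⟨y, ?_⟩
  rw [← hk, hy, map_mul, map_mul, map_inv, ← MonoidHom.comp_apply k f, hkf, MonoidHom.id_apply]

/-- Every finite subgroup of an amalgamated free product `G₁ *_A G₂` is conjugate to a
subgroup of (the image of) one of the factors `G₁`, `G₂`. -/
theorem finite_subgroup_of_amalgam_conjugate_into_factor
    {A G₁ G₂ P : Type u} [Group A] [Group G₁] [Group G₂] [Group P]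
    (α₁ : A →* G₁) (α₂ : A →* G₂)
    (hα₁ : Function.Injective α₁) (hα₂ : Function.Injective α₂)
    (κ₁ : G₁ →* P) (κ₂ : G₂ →* P)
    (hP : IsAmalgamatedFreeProduct α₁ α₂ κ₁ κ₂)
    (H : Subgroup P) (hH : Finite H) :
    ∃ g : P, (∀ x ∈ H, g * x * g⁻¹ ∈ κ₁.range) ∨ (∀ x ∈ H, g * x * g⁻¹ ∈ κ₂.range) := by
  let _ : ∀ b, Group (cond b G₁ G₂) := Bool.rec ‹Group G₂› ‹Group G₁›
  obtain ⟨g, b, hg⟩ := exists_conj_mem_range_of_isAmalgamatedFreeProduct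
    (G := fun b => cond b G₁ G₂) (fun b => b.rec α₂ α₁) (Bool.rec hα₂ hα₁)
    (fun b => b.rec κ₂ κ₁) hP H
  cases b with
  | true => exact ⟨g, Or.inl hg⟩
  | false => exact ⟨g, Or.inr hg⟩
end

section
/- Let A, G₁, G₂ be groups and α₁ : A → G₁, α₂ : A → G₂ injective group homomorphisms, and let P = G₁ *_A G₂ with canonical homomorphisms κ₁ : G₁ → P and κ₂ : G₂ → P. Then the intersection of the images κ₁(G₁) ∩ κ₂(G₂) equals the image κ₁(α₁(A)) of the amalgamated subgroup A in P (which also equals κ₂(α₂(A))). -/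
universe u

/-- The pair `G₁`, `G₂` as a family indexed by `Bool`. -/
def FactorFamily (G₁ G₂ : Type u) (b : Bool) : Type u :=
  match b with
  | true => G₁
  | false => G₂

instance (G₁ G₂ : Type u) [Group G₁] [Group G₂] (b : Bool) : Group (FactorFamily G₁ G₂ b) :=
  match b with
  | true => inferInstanceAs (Group G₁)
  | false => inferInstanceAs (Group G₂)

/-- The pair `α₁`, `α₂` as a family of homomorphisms indexed by `Bool`. -/
def factorHom {A G₁ G₂ : Type u} [Group A] [Group G₁] [Group G₂]
    (α₁ : A →* G₁) (α₂ : A →* G₂) (b : Bool) : A →* FactorFamily G₁ G₂ b :=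
  match b with
  | true => α₁
  | false => α₂

theorem factorHom_injective {A G₁ G₂ : Type u} [Group A] [Group G₁] [Group G₂]
    {α₁ : A →* G₁} {α₂ : A →* G₂}
    (hα₁ : Function.Injective α₁) (hα₂ : Function.Injective α₂) (b : Bool) :
    Function.Injective (factorHom α₁ α₂ b) :=
  match b with
  | true => hα₁
  | false => hα₂

/-- In an amalgamated free product `P = G₁ *_A G₂`, the intersection of the images of the
two factors equals the image of the amalgamated subgroup `A`. -/
theorem amalgam_factor_intersection
    {A G₁ G₂ P : Type u} [Group A] [Group G₁] [Group G₂] [Group P]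
    (α₁ : A →* G₁) (α₂ : A →* G₂)
    (hα₁ : Function.Injective α₁) (hα₂ : Function.Injective α₂)
    (κ₁ : G₁ →* P) (κ₂ : G₂ →* P)
    (hP : IsAmalgamatedFreeProduct α₁ α₂ κ₁ κ₂) :
    κ₁.range ⊓ κ₂.range = (κ₁.comp α₁).range := by
  obtain ⟨hcomm, huniv⟩ := hP
  have hinj := factorHom_injective hα₁ hα₂
  let φ := factorHom α₁ α₂
  let ι₁ : G₁ →* Monoid.PushoutI φ := Monoid.PushoutI.of (φ := φ) true
  let ι₂ : G₂ →* Monoid.PushoutI φ := Monoid.PushoutI.of (φ := φ) false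
  have hι₁ : ι₁.comp α₁ = Monoid.PushoutI.base φ := Monoid.PushoutI.of_comp_eq_base (φ := φ) true
  have hι₂ : ι₂.comp α₂ = Monoid.PushoutI.base φ := Monoid.PushoutI.of_comp_eq_base (φ := φ) false
  obtain ⟨h, ⟨h₁, h₂⟩, -⟩ := huniv (Monoid.PushoutI φ) ι₁ ι₂ (hι₁.trans hι₂.symm)
  apply le_antisymm
  · rintro x ⟨⟨g₁, rfl⟩, ⟨g₂, hg⟩⟩
    have hmem : ι₁ g₁ ∈ (Monoid.PushoutI.base φ).range := by
      rw [← Monoid.PushoutI.inf_of_range_eq_base_range hinj (i := true) (j := false) (by decide)]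
      refine ⟨⟨g₁, rfl⟩, ⟨g₂, ?_⟩⟩
      change ι₂ g₂ = ι₁ g₁
      rw [← h₁, ← h₂, MonoidHom.comp_apply, MonoidHom.comp_apply, hg]
    obtain ⟨a, ha⟩ := hmem
    rw [← hι₁] at ha
    exact ⟨a, congrArg κ₁ (Monoid.PushoutI.of_injective hinj true ha)⟩
  · rintro x ⟨a, rfl⟩
    exact ⟨⟨α₁ a, rfl⟩, ⟨α₂ a, (DFunLike.congr_fun hcomm a).symm⟩⟩
end

section
/- Let (P, ≤) be a countably directed poset and let (X_p, f_{pq}) be an inverse system of finite sets over P, with limit L and projections proj_p : L → X_p. Then there exist p₀ ∈ P and q ∈ P with p₀ ≤ q such that: (a) the projection proj_{p₀} : L → X_{p₀} is injective (in particular L is finite), and (b) the image proj_{p₀}(L) equals the image f_{p₀q}(X_q) of the structure map f_{p₀q} : X_q → X_{p₀}. -/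
open CategoryTheory in
/-- An inverse system of nonempty finite sets over a directed poset has a compatible family. -/
theorem exists_compatible_of_finite {P : Type*} [PartialOrder P] [IsDirectedOrder P]
    (X : P → Type*) [∀ p, Finite (X p)] [∀ p, Nonempty (X p)]
    (f : ∀ ⦃p q : P⦄, p ≤ q → X q → X p)
    (hf_id : ∀ (p : P) (x : X p), f (le_refl p) x = x)
    (hf_comp : ∀ (p q r : P) (hpq : p ≤ q) (hqr : q ≤ r) (x : X r),
      f hpq (f hqr x) = f (hpq.trans hqr) x) :
    ∃ s : ∀ p, X p, ∀ ⦃p q : P⦄ (h : p ≤ q), f h (s q) = s p := by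
  let F : Pᵒᵖ ⥤ Type _ :=
    { obj := fun p => X p.unop
      map := fun g => TypeCat.ofHom (f (leOfHom g.unop))
      map_id := fun p => by ext x; exact hf_id p.unop x
      map_comp := fun g h => by ext x; exact (hf_comp _ _ _ _ _ x).symm }
  have : ∀ p : Pᵒᵖ, Finite (F.obj p) := fun p => inferInstanceAs (Finite (X p.unop))
  have : ∀ p : Pᵒᵖ, Nonempty (F.obj p) := fun p => inferInstanceAs (Nonempty (X p.unop))
  obtain ⟨s, hs⟩ := nonempty_sections_of_finite_inverse_system F
  exact ⟨fun p => s (.op p), fun p q h => hs (homOfLE h).op⟩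

/-- In an inverse system of finite sets, a point that lifts to every later stage extends to a
compatible family. -/
theorem exists_compatible_through {P : Type*} [PartialOrder P] [IsDirectedOrder P]
    (X : P → Type*) [∀ p, Finite (X p)]
    (f : ∀ ⦃p q : P⦄, p ≤ q → X q → X p)
    (hf_id : ∀ (p : P) (x : X p), f (le_refl p) x = x)
    (hf_comp : ∀ (p q r : P) (hpq : p ≤ q) (hqr : q ≤ r) (x : X r),
      f hpq (f hqr x) = f (hpq.trans hqr) x)
    (p₀ : P) (x : X p₀) (hx : ∀ q (h : p₀ ≤ q), x ∈ Set.range (f h)) :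
    ∃ s : ∀ p, X p, (∀ ⦃p q : P⦄ (h : p ≤ q), f h (s q) = s p) ∧ s p₀ = x := by
  let Y : P → Type _ := fun q => {y : X q // ∀ h : p₀ ≤ q, f h y = x}
  have hY : ∀ q, Nonempty (Y q) := fun q => by
    obtain ⟨r, hqr, hpr⟩ := exists_ge_ge q p₀
    obtain ⟨y, hy⟩ := hx r hpr
    exact ⟨f hqr y, fun h => by rw [hf_comp, hy]⟩
  obtain ⟨s, hs⟩ := exists_compatible_of_finite Y
    (fun p q h y => ⟨f h y.1, fun h' => by rw [hf_comp, y.2]⟩)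
    (fun p y => Subtype.ext (hf_id p y.1))
    (fun p q r hpq hqr y => Subtype.ext (hf_comp p q r hpq hqr y.1))
  refine ⟨fun p => (s p).1, fun p q h => congrArg Subtype.val (hs h), ?_⟩
  exact (hf_id p₀ (s p₀).1).symm.trans ((s p₀).2 le_rfl)

/-- For a set of families compatible with an inverse system of finite sets over a countably
directed poset, evaluation at some index is injective. -/
theorem exists_injOn_eval {P : Type*} [PartialOrder P]
    (hdir : ∀ s : Set P, s.Countable → ∃ ub : P, ∀ p ∈ s, p ≤ ub)
    (X : P → Type*) [∀ p, Finite (X p)]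
    (f : ∀ ⦃p q : P⦄, p ≤ q → X q → X p)
    (S : Set (∀ p, X p)) (hS : ∀ s ∈ S, ∀ ⦃p q : P⦄ (h : p ≤ q), f h (s q) = s p) :
    ∃ p₀ : P, Set.InjOn (fun s : ∀ p, X p => s p₀) S := by
  let E : ∀ p, Set (X p) := fun p => (fun s : ∀ p, X p => s p) '' S
  have himage : ∀ ⦃p q : P⦄ (h : p ≤ q), f h '' E q = E p := fun p q h => by
    simp only [E, Set.image_image]
    exact Set.image_congr fun s hs => hS s hs h
  have hmono : ∀ ⦃p q : P⦄, p ≤ q → (E p).ncard ≤ (E q).ncard := fun p q h => by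
    rw [← himage h]
    exact Set.ncard_image_le (Set.toFinite _)
  obtain ⟨p₀, hp₀⟩ : ∃ p₀, ∀ q, (E q).ncard ≤ (E p₀).ncard := by
    obtain ⟨c, hc⟩ := hdir ∅ Set.countable_empty
    have hbdd : BddAbove (Set.range fun p => (E p).ncard) := by
      by_contra hunbdd
      simp only [not_bddAbove_iff, Set.exists_range_iff] at hunbdd
      choose p hp using hunbdd
      obtain ⟨u, hu⟩ := hdir (Set.range p) (Set.countable_range p)
      exact ((hp (E u).ncard).trans_le (hmono (hu _ ⟨_, rfl⟩))).false
    obtain ⟨p₀, hp₀⟩ := Nat.sSup_mem ⟨_, Set.mem_range_self c⟩ hbdd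
    exact ⟨p₀, fun q => (le_csSup hbdd ⟨q, rfl⟩).trans_eq hp₀.symm⟩
  refine ⟨p₀, fun s hs t ht hst => funext fun p => ?_⟩
  obtain ⟨r, hr⟩ := hdir {p, p₀} (Set.toFinite _).countable
  have hpr : p ≤ r := hr p (by simp)
  have hp₀r : p₀ ≤ r := hr p₀ (by simp)
  have hinj : Set.InjOn (f hp₀r) (E r) := by
    refine Set.injOn_of_ncard_image_eq ?_ (Set.toFinite _)
    rw [himage hp₀r]
    exact (hmono hp₀r).antisymm (hp₀ r)
  have : s r = t r := hinj ⟨s, hs, rfl⟩ ⟨t, ht, rfl⟩ (by rw [hS s hs, hS t ht]; exact hst)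
  rw [← hS s hs hpr, ← hS t ht hpr, this]

/-- For a countably codirected inverse system of finite sets `(X p, f)` there are indices
`p₀ ≤ q` such that the projection of the limit to `X p₀` is injective (so the limit is
finite) and its image coincides with the image of the structure map `f : X q → X p₀`. -/
theorem countablyCodirected_limit_of_finite_sets
    {P : Type*} [PartialOrder P] [Nonempty P]
    (hdir : ∀ s : Set P, s.Countable → ∃ ub : P, ∀ p ∈ s, p ≤ ub)
    (X : P → Type*) [∀ p, Finite (X p)]
    (f : ∀ ⦃p q : P⦄, p ≤ q → X q → X p)
    (hf_id : ∀ (p : P) (x : X p), f (le_refl p) x = x)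
    (hf_comp : ∀ (p q r : P) (hpq : p ≤ q) (hqr : q ≤ r) (x : X r),
      f hpq (f hqr x) = f (hpq.trans hqr) x) :
    ∃ (p₀ q : P) (h : p₀ ≤ q),
      Function.Injective
          (fun s : {s : ∀ p, X p // ∀ ⦃p q : P⦄ (h : p ≤ q), f h (s q) = s p} => s.1 p₀) ∧
        Finite {s : ∀ p, X p // ∀ ⦃p q : P⦄ (h : p ≤ q), f h (s q) = s p} ∧
        Set.range
            (fun s : {s : ∀ p, X p // ∀ ⦃p q : P⦄ (h : p ≤ q), f h (s q) = s p} => s.1 p₀) =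
          Set.range (f h) := by
  have : IsDirectedOrder P := ⟨fun a b => by
    obtain ⟨c, hc⟩ := hdir {a, b} (Set.toFinite _).countable
    exact ⟨c, hc a (by simp), hc b (by simp)⟩⟩
  obtain ⟨p₀, hp₀⟩ := exists_injOn_eval hdir X f
    {s | ∀ ⦃p q : P⦄ (h : p ≤ q), f h (s q) = s p} fun s hs => hs
  have hinj : Function.Injective
      (fun s : {s : ∀ p, X p // ∀ ⦃p q : P⦄ (h : p ≤ q), f h (s q) = s p} => s.1 p₀) :=
    fun s t hst => Subtype.ext (hp₀ s.2 t.2 hst)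
  have hlift : ∀ x : X p₀, ∃ q, ∃ h : p₀ ≤ q, x ∈ Set.range (f h) →
      ∃ s : ∀ p, X p, (∀ ⦃p q : P⦄ (h : p ≤ q), f h (s q) = s p) ∧ s p₀ = x := fun x => by
    by_contra! hx
    obtain ⟨s, hs, hsx⟩ := exists_compatible_through X f hf_id hf_comp p₀ x
      fun q h => (hx q h).1
    exact (hx p₀ le_rfl).2 s hs hsx
  choose q hq hlift using hlift
  obtain ⟨u, hu⟩ := hdir (insert p₀ (Set.range q)) (Set.toFinite _).countable
  have hp₀u : p₀ ≤ u := hu p₀ (Set.mem_insert _ _)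
  refine ⟨p₀, u, hp₀u, hinj, Finite.of_injective _ hinj, Set.Subset.antisymm ?_ ?_⟩
  · rintro _ ⟨s, rfl⟩
    exact ⟨s.1 u, s.2 hp₀u⟩
  · rintro _ ⟨y, rfl⟩
    have hqu := hu (q (f hp₀u y)) (Set.mem_insert_of_mem _ ⟨_, rfl⟩)
    obtain ⟨s, hs, hsy⟩ := hlift (f hp₀u y) ⟨f hqu y, hf_comp _ _ _ _ _ y⟩
    exact ⟨⟨s, hs⟩, hsy⟩
end

section
/- Let (P, ≤) be a countably directed poset and let (X_p, f_{pq}) be an inverse system of sets over P. Suppose that for each p ∈ P a finite subset D_p ⊆ X_p is given such that D_p ⊆ f_{pq}(D_q) for all p ≤ q. Then there exist finite subsets E_p ⊆ X_p with D_p ⊆ E_p for every p ∈ P and f_{pq}(E_q) ⊆ E_p for all p ≤ q (so that the E_p form a sub-inverse-system). -/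
/-- Given a countably codirected inverse system of sets `(X p, f)` and finite subsets
`D p ⊆ X p` with `D p ⊆ f (D q)` for all `p ≤ q`, there are finite subsets
`E p ⊇ D p` forming a sub-inverse-system, i.e. `f '' (E q) ⊆ E p` for all `p ≤ q`. -/
theorem countablyCodirected_closure_of_finite_subsets
    {P : Type*} [PartialOrder P] [Nonempty P]
    (hdir : ∀ s : Set P, s.Countable → ∃ ub : P, ∀ p ∈ s, p ≤ ub)
    (X : P → Type*)
    (f : ∀ ⦃p q : P⦄, p ≤ q → X q → X p)
    (hf_id : ∀ (p : P) (x : X p), f (le_refl p) x = x)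
    (hf_comp : ∀ (p q r : P) (hpq : p ≤ q) (hqr : q ≤ r) (x : X r),
      f hpq (f hqr x) = f (hpq.trans hqr) x)
    (D : ∀ p, Set (X p)) (hDfin : ∀ p, (D p).Finite)
    (hD : ∀ (p q : P) (h : p ≤ q), D p ⊆ f h '' D q) :
    ∃ E : ∀ p, Set (X p),
      (∀ p, (E p).Finite) ∧ (∀ p, D p ⊆ E p) ∧
        ∀ (p q : P) (h : p ≤ q), f h '' E q ⊆ E p := by
  refine ⟨fun p => ⋃ (q : P) (h : p ≤ q), f h '' D q, fun p => ?_, fun p x hx => ?_, ?_⟩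
  · by_contra hinf
    obtain ⟨T, hTsub, hTcount, hTinf⟩ := Set.Infinite.exists_subset_countable_infinite hinf
    have hmem : ∀ x ∈ T, ∃ q, ∃ h : p ≤ q, x ∈ f h '' D q := fun x hx => by
      simpa only [Set.mem_iUnion] using hTsub hx
    choose! q hpq hq using hmem
    obtain ⟨r, hr⟩ := hdir (q '' T) (hTcount.image q)
    obtain ⟨x₀, hx₀⟩ := hTinf.nonempty
    have hpr : p ≤ r := (hpq x₀ hx₀).trans (hr _ (Set.mem_image_of_mem q hx₀))
    refine hTinf (((hDfin r).image (f hpr)).subset fun x hx => ?_)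
    have hqr := hr _ (Set.mem_image_of_mem q hx)
    obtain ⟨y, hy, hyx⟩ := hq x hx
    obtain ⟨z, hz, rfl⟩ := hD _ _ hqr hy
    exact ⟨z, hz, (hf_comp _ _ _ _ _ z).symm.trans hyx⟩
  · exact Set.mem_iUnion₂.2 ⟨p, le_refl p, x, hx, hf_id p x⟩
  · rintro p q h _ ⟨y, hy, rfl⟩
    obtain ⟨r, hqr, z, hz, rfl⟩ := Set.mem_iUnion₂.1 hy
    exact Set.mem_iUnion₂.2 ⟨r, h.trans hqr, z, hz, (hf_comp _ _ _ h hqr z).symm⟩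
end

section
/- Fix a point a ∈ Fin 12 and let S = {σ ∈ A₁₂ : σ(a) = a} be the stabilizer of a in A₁₂. Then every group homomorphism f : A₁₂ → A₁₂ satisfying f(σ) = σ for all σ ∈ S is the identity homomorphism. -/
open Equiv Equiv.Perm in
/-- An even permutation commuting with all even permutations that fix `a` and `b` is trivial. -/
theorem eq_one_of_commute_of_fix_pair {α : Type*} [Fintype α] [DecidableEq α]
    (hα : 6 ≤ Fintype.card α) (a b : α) (g : Perm α) (hg : sign g = 1)
    (hcomm : ∀ τ : Perm α, sign τ = 1 → τ a = a → τ b = b → g * τ = τ * g) : g = 1 := by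
  have hfix : ∀ x, x ≠ a → x ≠ b → g x = x := by
    intro x hxa hxb
    by_contra hgx
    have hcard : 1 < (({a, b, x, g x} : Finset α)ᶜ).card := by
      have := Finset.card_le_four (a := a) (b := b) (c := x) (d := g x)
      rw [Finset.card_compl]
      omega
    obtain ⟨z, hz, w, hw, hzw⟩ := Finset.one_lt_card.mp hcard
    simp only [Finset.mem_compl, Finset.mem_insert, Finset.mem_singleton, not_or] at hz hw
    obtain ⟨hza, hzb, hzx, hzg⟩ := hz
    obtain ⟨hwa, hwb, hwx, hwg⟩ := hw
    have h := congrArg (fun p : Perm α => p x)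
      (hcomm (swap x z * swap x w) (by simp [sign_swap (Ne.symm hzx), sign_swap (Ne.symm hwx)])
        (by simp [swap_apply_of_ne_of_ne, hxa.symm, Ne.symm hza, Ne.symm hwa])
        (by simp [swap_apply_of_ne_of_ne, hxb.symm, Ne.symm hzb, Ne.symm hwb]))
    simp only [Perm.mul_apply, swap_apply_left, swap_apply_of_ne_of_ne hgx (Ne.symm hwg),
      swap_apply_of_ne_of_ne hgx (Ne.symm hzg), swap_apply_of_ne_of_ne hwx (Ne.symm hzw)] at h
    exact hwx (g.injective h)
  have hsupp : g.support ⊆ {a, b} := by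
    intro x hx
    by_contra hxab
    simp only [Finset.mem_insert, Finset.mem_singleton, not_or] at hxab
    exact mem_support.mp hx (hfix x hxab.1 hxab.2)
  by_contra hne
  have htwo : g.support.card = 2 :=
    le_antisymm ((Finset.card_le_card hsupp).trans Finset.card_le_two)
      (two_le_card_support_of_ne_one hne)
  rw [(card_support_eq_two.mp htwo).sign_eq] at hg
  exact absurd hg (by decide)

/-- A homomorphism `A₁₂ → A₁₂` which is the identity on the stabilizer of a point
is the identity. -/
theorem hom_of_A12_fixing_point_stabilizer_is_id (a : Fin 12)
    (S : Subgroup (alternatingGroup (Fin 12)))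
    (hS : ∀ σ : alternatingGroup (Fin 12), σ ∈ S ↔ (σ : Equiv.Perm (Fin 12)) a = a)
    (f : alternatingGroup (Fin 12) →* alternatingGroup (Fin 12))
    (hf : ∀ σ ∈ S, f σ = σ) :
    f = MonoidHom.id (alternatingGroup (Fin 12)) := by
  ext1 σ
  have key : ((σ⁻¹ * f σ : alternatingGroup (Fin 12)) : Equiv.Perm (Fin 12)) = 1 := by
    refine eq_one_of_commute_of_fix_pair (by simp) a ((σ : Equiv.Perm (Fin 12))⁻¹ a) _
      (σ⁻¹ * f σ).2 fun τ hτ hτa hτb => ?_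
    lift τ to alternatingGroup (Fin 12) using hτ
    have hτS : f τ = τ := hf τ ((hS τ).mpr hτa)
    have hconj : f (σ * τ * σ⁻¹) = σ * τ * σ⁻¹ :=
      hf _ ((hS _).mpr (Equiv.Perm.eq_inv_iff_eq (f := (σ : Equiv.Perm (Fin 12))).mp hτb))
    rw [map_mul, map_mul, map_inv, hτS, mul_inv_eq_iff_eq_mul] at hconj
    have hmul : σ⁻¹ * f σ * τ = τ * (σ⁻¹ * f σ) := by
      rw [mul_assoc, hconj]
      group
    exact congrArg Subtype.val hmul
  exact (inv_mul_eq_one.mp (Subtype.ext key)).symm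
end

section
/- Let j : A₁₁ → A₁₂ be the injective group homomorphism induced by the inclusion Fin 11 ↪ Fin 12 (extending each even permutation of Fin 11 to Fin 12 by fixing the added point). There is no group homomorphism f : A₁₂ → A₁₁ × A₁₂ such that f(j(x)) = (x, j(x)) for every x ∈ A₁₁. -/
/-- A homomorphism from a simple group to a nontrivial group which has a right inverse is
injective. -/
theorem IsSimpleGroup.injective_of_leftInverse {G H : Type*} [Group G] [Group H]
    [IsSimpleGroup G] [Nontrivial H] (r : G →* H) (j : H → G)
    (h : Function.LeftInverse r j) : Function.Injective r := by
  rw [← MonoidHom.ker_eq_bot_iff]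
  refine r.normal_ker.eq_bot_or_eq_top.resolve_right fun htop => ?_
  obtain ⟨y, hy⟩ := exists_ne (1 : H)
  exact hy <| by rw [← h y, ← MonoidHom.mem_ker, htop]; exact Subgroup.mem_top _

/-- A homomorphism `A_n → A_m` with `m < n` and `5 ≤ n` has no right inverse unless `A_m` is
trivial. -/
theorem alternatingGroup.not_leftInverse {m n : ℕ} (hm : 3 ≤ m) (hn : 5 ≤ n) (hmn : m < n)
    (r : alternatingGroup (Fin n) →* alternatingGroup (Fin m))
    (j : alternatingGroup (Fin m) → alternatingGroup (Fin n)) :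
    ¬ Function.LeftInverse r j := by
  intro h
  have : IsSimpleGroup (alternatingGroup (Fin n)) := alternatingGroup.isSimpleGroup (by simpa)
  have : Nontrivial (alternatingGroup (Fin m)) := nontrivial_of_three_le_card (by simpa)
  have : Nontrivial (Fin n) := Fin.nontrivial_iff_two_le.2 (by lia)
  have : Nontrivial (Fin m) := Fin.nontrivial_iff_two_le.2 (by lia)
  have hle := Nat.card_le_card_of_injective r (IsSimpleGroup.injective_of_leftInverse r j h)
  have hcard_n := two_mul_nat_card_alternatingGroup (α := Fin n)
  have hcard_m := two_mul_nat_card_alternatingGroup (α := Fin m)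
  rw [Nat.card_perm, Nat.card_fin] at hcard_n hcard_m
  have hlt := (Nat.factorial_lt (by lia : 0 < m)).2 hmn
  lia


/-- Let `j : A₁₁ → A₁₂` be the homomorphism induced by the inclusion `Fin 11 ↪ Fin 12`
(extending each even permutation by fixing the added point).  No homomorphism
`f : A₁₂ → A₁₁ × A₁₂` satisfies `f (j x) = (x, j x)` for all `x ∈ A₁₁`. -/
theorem no_retraction_of_A11_in_A12_times
    (j : alternatingGroup (Fin 11) →* alternatingGroup (Fin 12))
    (hj : ∀ (x : alternatingGroup (Fin 11)) (i : Fin 11),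
      (j x : Equiv.Perm (Fin 12)) (Fin.castSucc i) =
        Fin.castSucc ((x : Equiv.Perm (Fin 11)) i)) :
    ¬ ∃ f : alternatingGroup (Fin 12) →*
        alternatingGroup (Fin 11) × alternatingGroup (Fin 12),
      ∀ x : alternatingGroup (Fin 11), f (j x) = (x, j x) := by
  rintro ⟨f, hf⟩
  exact alternatingGroup.not_leftInverse (by simp) (by simp) (by simp)
    ((MonoidHom.fst _ _).comp f) j fun x => by simp [hf]
end

section
/- Let H be a subgroup of the symmetric group Perm (Fin 12) with exactly 55 elements. Then the centralizer of H in Perm (Fin 12) is trivial: every permutation σ of Fin 12 that commutes with all elements of H equals the identity. -/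
/-- The centralizer of a permutation of odd prime order `p` on at most `p + 1` points
has `p` elements. -/
theorem Equiv.Perm.nat_card_centralizer_of_prime_orderOf {α : Type*} [Fintype α] [DecidableEq α]
    {g : Equiv.Perm α} (hp : (orderOf g).Prime) (h2 : 2 < orderOf g)
    (hα : Fintype.card α ≤ orderOf g + 1) :
    Nat.card (Subgroup.centralizer {g}) = orderOf g := by
  have hc : g.IsCycle := isCycle_of_prime_order' hp (by lia)
  have hf : (Fintype.card α - orderOf g).factorial = 1 :=
    Nat.factorial_eq_one.mpr (by lia)
  simp [nat_card_centralizer, hc.cycleType, ← hc.orderOf, hf]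

/-- A subgroup of `Perm (Fin 12)` with exactly `55` elements has trivial centralizer:
any permutation commuting with all its elements is the identity. -/
theorem centralizer_of_order55_subgroup_trivial
    (H : Subgroup (Equiv.Perm (Fin 12))) (hH : Nat.card H = 55)
    (σ : Equiv.Perm (Fin 12)) (hσ : ∀ h ∈ H, σ * h = h * σ) :
    σ = 1 := by
  have card_centralizer (τ : Equiv.Perm (Fin 12)) (hτ : orderOf τ = 11) :
      Nat.card (Subgroup.centralizer {τ}) = 11 := by
    rw [Equiv.Perm.nat_card_centralizer_of_prime_orderOf] <;> norm_num [hτ]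
  have : Fact (Nat.Prime 11) := ⟨by norm_num⟩
  obtain ⟨⟨g, hgH⟩, hg⟩ := exists_prime_orderOf_dvd_card' (G := H) 11 (by norm_num [hH])
  rw [Subgroup.orderOf_mk] at hg
  have hσg : σ ∈ Subgroup.centralizer {g} :=
    Subgroup.mem_centralizer_singleton_iff.mpr (hσ g hgH)
  have hdvd : orderOf σ ∣ 11 := card_centralizer g hg ▸ Subgroup.orderOf_dvd_natCard _ hσg
  rcases (Nat.dvd_prime Fact.out).mp hdvd with h1 | h11
  · exact orderOf_eq_one_iff.mp h1
  · have hle : H ≤ Subgroup.centralizer {σ} := fun h hh =>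
      Subgroup.mem_centralizer_singleton_iff.mpr (hσ h hh).symm
    have := Subgroup.card_le_of_le hle
    rw [hH, card_centralizer σ h11] at this
    norm_num at this
end

section
/- Every automorphism of the alternating group A₁₂ is induced by conjugation by a permutation: for every group automorphism φ : A₁₂ → A₁₂ there exists s ∈ Perm (Fin 12) such that φ(x) = s x s⁻¹ (computed in Perm (Fin 12)) for all x ∈ A₁₂. -/
open Equiv Equiv.Perm

/-- The permutation `a ↦ b ↦ c ↦ a`, when `a`, `b`, `c` are distinct. -/
def threeCycle {α : Type*} [DecidableEq α] (a b c : α) : Perm α := swap a b * swap b c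

theorem conj_threeCycle {α : Type*} [DecidableEq α] (g : Perm α) (a b c : α) :
    g * threeCycle a b c * g⁻¹ = threeCycle (g a) (g b) (g c) := by
  simp only [threeCycle, swap_apply_apply]
  group

theorem isThreeCycle_threeCycle {α : Type*} [DecidableEq α] [Fintype α] {a b c : α}
    (hab : a ≠ b) (hbc : b ≠ c) (hca : c ≠ a) : (threeCycle a b c).IsThreeCycle := by
  rw [threeCycle, swap_comm]
  exact isThreeCycle_swap_mul_swap_same hab.symm hbc hca.symm

theorem exists_threeCycle_eq {α : Type*} [DecidableEq α] [Fintype α] {g : Perm α}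
    (hg : g.IsThreeCycle) : ∃ a b c, a ≠ b ∧ b ≠ c ∧ c ≠ a ∧ g = threeCycle a b c := by
  obtain ⟨a, ha⟩ : g.support.Nonempty := by
    rw [Finset.nonempty_iff_ne_empty, ne_eq, support_eq_empty_iff]
    exact hg.ne_one
  have hn := hg.nodup_iff_mem_support.mpr ha
  refine ⟨a, g a, g (g a), ?_, ?_, ?_, hg.eq_swap_mul_swap_iff_mem_support.mpr ha⟩ <;> grind

/-- Two 3-cycles on `Fin 12` whose product is an involution are simultaneously conjugate to
`(0 1 2)` and `(0 1 3)`: the case where the first one is `(0 1 2)` already. -/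
theorem exists_conj_threeCycle_zero_one_three : ∀ p q r : Fin 12, p ≠ q → q ≠ r → r ≠ p →
    (threeCycle 0 1 2 * threeCycle p q r) ^ 2 = 1 → threeCycle 0 1 2 * threeCycle p q r ≠ 1 →
    ∃ d : Fin 12, ∃ i : Fin 3,
      (swap 3 d * threeCycle 0 1 2 ^ (i : ℕ)) * threeCycle 0 1 2 *
        (swap 3 d * threeCycle 0 1 2 ^ (i : ℕ))⁻¹ = threeCycle 0 1 2 ∧
      (swap 3 d * threeCycle 0 1 2 ^ (i : ℕ)) * threeCycle p q r *
        (swap 3 d * threeCycle 0 1 2 ^ (i : ℕ))⁻¹ = threeCycle 0 1 3 := by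
  decide +kernel

theorem exists_eq_threeCycle_zero_one : ∀ p q r : Fin 12, p ≠ q → q ≠ r → r ≠ p →
    (threeCycle 0 1 2 * threeCycle p q r) ^ 2 = 1 → threeCycle 0 1 2 * threeCycle p q r ≠ 1 →
    (threeCycle 0 1 3 * threeCycle p q r) ^ 2 = 1 → threeCycle 0 1 3 * threeCycle p q r ≠ 1 →
    ∃ d : Fin 12, 2 ≤ d ∧ threeCycle p q r = threeCycle 0 1 d := by
  decide +kernel

theorem threeCycle_zero_one_mul : ∀ j k : Fin 12, 2 ≤ j → 2 ≤ k → j ≠ k →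
    (threeCycle 0 1 j * threeCycle 0 1 k) ^ 2 = 1 ∧ threeCycle 0 1 j * threeCycle 0 1 k ≠ 1 := by
  decide +kernel

theorem threeCycle_rotate : ∀ a b c : Fin 12, a ≠ b → b ≠ c → c ≠ a →
    threeCycle a b c = threeCycle b c a := by
  decide +kernel

theorem threeCycle_zero_right_one : ∀ b : Fin 12, 2 ≤ b →
    threeCycle 0 b 1 = (threeCycle 0 1 b)⁻¹ := by
  decide +kernel

theorem threeCycle_one_left : ∀ b c : Fin 12, 2 ≤ b → 2 ≤ c → b ≠ c →
    threeCycle 1 b c = threeCycle 0 1 b * threeCycle 0 1 c * (threeCycle 0 1 b)⁻¹ := by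
  decide +kernel

theorem threeCycle_zero_left : ∀ b c : Fin 12, 2 ≤ b → 2 ≤ c → b ≠ c →
    threeCycle 0 b c = threeCycle 0 1 c * threeCycle 1 c b * (threeCycle 0 1 c)⁻¹ := by
  decide +kernel

theorem threeCycle_of_two_le : ∀ a b c : Fin 12, 2 ≤ a → 2 ≤ b → 2 ≤ c →
    a ≠ b → b ≠ c → c ≠ a →
    threeCycle a b c = threeCycle 0 1 a * threeCycle 1 b c * (threeCycle 0 1 a)⁻¹ := by
  decide +kernel

theorem alternatingGroup_le_of_threeCycle_zero_one_mem {H : Subgroup (Perm (Fin 12))}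
    (hH : ∀ k, 2 ≤ k → threeCycle 0 1 k ∈ H) : alternatingGroup (Fin 12) ≤ H := by
  have one_mem : ∀ b c : Fin 12, b ≠ c → 2 ≤ b → 2 ≤ c → threeCycle 1 b c ∈ H := by
    intro b c hbc hb hc
    rw [threeCycle_one_left b c hb hc hbc]
    exact mul_mem (mul_mem (hH b hb) (hH c hc)) (inv_mem (hH b hb))
  have key : ∀ a b c : Fin 12, a ≠ b → b ≠ c → c ≠ a → a < b → a < c → threeCycle a b c ∈ H := by
    intro a b c hab hbc hca h1 h2
    by_cases ha : a = 0
    · subst ha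
      by_cases hb : b = 1
      · subst hb
        exact hH c (by grind)
      · by_cases hc : c = 1
        · subst hc
          rw [threeCycle_zero_right_one b (by grind)]
          exact inv_mem (hH b (by grind))
        · have hb : 2 ≤ b := by grind
          have hc : 2 ≤ c := by grind
          rw [threeCycle_zero_left b c hb hc hbc]
          exact mul_mem (mul_mem (hH c hc) (one_mem c b hbc.symm hc hb)) (inv_mem (hH c hc))
    · have hb : 2 ≤ b := by grind
      have hc : 2 ≤ c := by grind
      by_cases ha1 : a = 1
      · subst ha1
        exact one_mem b c hbc hb hc
      · have ha : 2 ≤ a := by grind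
        rw [threeCycle_of_two_le a b c ha hb hc hab hbc hca]
        exact mul_mem (mul_mem (hH a ha) (one_mem b c hbc hb hc)) (inv_mem (hH a ha))
  rw [← closure_three_cycles_eq_alternating, Subgroup.closure_le]
  intro g hg
  obtain ⟨a, b, c, hab, hbc, hca, rfl⟩ := exists_threeCycle_eq hg
  have r1 := threeCycle_rotate a b c hab hbc hca
  have r2 := threeCycle_rotate b c a hbc hca hab
  rcases lt_or_gt_of_ne hab with h1 | h1 <;> rcases lt_or_gt_of_ne hbc with h2 | h2
  · exact key a b c hab hbc hca h1 (h1.trans h2)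
  · rcases lt_or_gt_of_ne hca with h3 | h3
    · rw [r1, r2]; exact key c a b hca hab hbc h3 h2
    · exact key a b c hab hbc hca h1 h3
  · rw [r1]; exact key b c a hbc hca hab h2 h1
  · rw [r1, r2]; exact key c a b hca hab hbc (h2.trans h1) h2

theorem card_centralizer_alternatingGroup_le {α : Type*} [DecidableEq α] [Fintype α]
    (g : alternatingGroup α) :
    Nat.card (Subgroup.centralizer {g}) ≤ Nat.card (Subgroup.centralizer {(g : Perm α)}) := by
  refine Nat.card_le_card_of_injective
    (fun x ↦ ⟨x.1.1, by
      have := x.2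
      rw [Subgroup.mem_centralizer_singleton_iff] at this ⊢
      exact congrArg Subtype.val this⟩) fun x y h ↦ ?_
  exact Subtype.ext (Subtype.ext (congrArg (fun z ↦ z.1) h))

theorem card_centralizer_le_two_mul {α : Type*} [DecidableEq α] [Fintype α] [Nontrivial α]
    (g : alternatingGroup α) :
    Nat.card (Subgroup.centralizer {(g : Perm α)}) ≤ 2 * Nat.card (Subgroup.centralizer {g}) := by
  set C := Subgroup.centralizer {(g : Perm α)}
  have h1 := ((alternatingGroup α).subgroupOf C).card_mul_index
  have h2 : ((alternatingGroup α).subgroupOf C).index ≤ 2 := by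
    rw [← alternatingGroup.index_eq_two (α := α)]
    exact Nat.le_of_dvd (by rw [alternatingGroup.index_eq_two]; decide)
      (Subgroup.relIndex_dvd_index_of_normal _ _)
  have h3 : Nat.card ((alternatingGroup α).subgroupOf C) ≤
      Nat.card (Subgroup.centralizer {g}) := by
    refine Nat.card_le_card_of_injective
      (fun x ↦ ⟨⟨x.1.1, x.2⟩, by
        have := x.1.2
        rw [Subgroup.mem_centralizer_singleton_iff] at this ⊢
        exact Subtype.ext this⟩) fun x y h ↦ ?_
    exact Subtype.ext (Subtype.ext (congrArg (fun z ↦ z.1.1) h))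
  nlinarith

theorem card_centralizer_map {G : Type*} [Group G] (φ : G ≃* G) (g : G) :
    Nat.card (Subgroup.centralizer {φ g}) = Nat.card (Subgroup.centralizer {g}) := by
  refine (Nat.card_congr (φ.toEquiv.subtypeEquiv fun x ↦ ?_)).symm
  simp only [Subgroup.mem_centralizer_singleton_iff]
  simp [← map_mul]

theorem isThreeCycle_or_card_centralizer_le {g : Perm (Fin 12)} (hg : orderOf g = 3) :
    g.IsThreeCycle ∧ Nat.card (Subgroup.centralizer {g}) = 1088640 ∨
      Nat.card (Subgroup.centralizer {g}) ≤ 12960 := by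
  obtain ⟨n, hn⟩ := cycleType_prime_order (hg ▸ Nat.prime_three)
  have hs := sum_cycleType_le g
  rw [nat_card_centralizer]
  rw [hg] at hn
  simp only [hn, Fintype.card_fin, Multiset.sum_replicate, smul_eq_mul] at hs
  have : n ≤ 3 := by omega
  rw [IsThreeCycle, hn]
  interval_cases n
  · left; constructor
    · rfl
    · decide +kernel
  all_goals right; decide +kernel

theorem isThreeCycle_map (φ : alternatingGroup (Fin 12) ≃* alternatingGroup (Fin 12))
    {g : alternatingGroup (Fin 12)} (hg : (g : Perm (Fin 12)).IsThreeCycle) :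
    (φ g : Perm (Fin 12)).IsThreeCycle := by
  have ho : orderOf (φ g : Perm (Fin 12)) = 3 := by
    rw [Subgroup.orderOf_coe, MulEquiv.orderOf_eq, ← Subgroup.orderOf_coe, hg.orderOf]
  rcases isThreeCycle_or_card_centralizer_le ho with h | h
  · exact h.1
  · have h1 := card_centralizer_le_two_mul g
    have h2 := card_centralizer_alternatingGroup_le (φ g)
    rw [card_centralizer_map] at h2
    have h3 : Nat.card (Subgroup.centralizer {(g : Perm (Fin 12))}) = 1088640 := by
      rw [nat_card_centralizer, hg.cycleType]
      decide +kernel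
    omega

/-- Two 3-cycles on `Fin 12` whose product is an involution are simultaneously conjugate to
`(0 1 2)` and `(0 1 3)`. -/
theorem exists_conj_pair {u v : Perm (Fin 12)} (hu : u.IsThreeCycle) (hv : v.IsThreeCycle)
    (h2 : (u * v) ^ 2 = 1) (h1 : u * v ≠ 1) :
    ∃ s : Perm (Fin 12), s * u * s⁻¹ = threeCycle 0 1 2 ∧ s * v * s⁻¹ = threeCycle 0 1 3 := by
  have h012 : (threeCycle (0 : Fin 12) 1 2).IsThreeCycle :=
    isThreeCycle_threeCycle (by decide) (by decide) (by decide)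
  obtain ⟨t, ht⟩ := isConj_iff.mp (isConj_of_cycleType_eq (hu.cycleType.trans h012.cycleType.symm))
  have hv' : (t * v * t⁻¹).IsThreeCycle := by
    rw [IsThreeCycle, cycleType_conj]; exact hv
  obtain ⟨p, q, r, hpq, hqr, hrp, he⟩ := exists_threeCycle_eq hv'
  have hc : threeCycle 0 1 2 * threeCycle p q r = t * (u * v) * t⁻¹ := by
    rw [← ht, ← he]; group
  obtain ⟨d, i, hd1, hd2⟩ := exists_conj_threeCycle_zero_one_three p q r hpq hqr hrp
    (by rw [hc, conj_pow, h2]; simp) (by rw [hc]; simpa using h1)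
  refine ⟨swap 3 d * threeCycle 0 1 2 ^ (i : ℕ) * t, ?_, ?_⟩
  · refine Eq.trans ?_ hd1
    nth_rw 4 [← ht]
    simp only [mul_inv_rev, mul_assoc]
  · rw [← hd2, ← he]; group

/-- Every automorphism of `A₁₂` is induced by conjugation by a permutation of `Fin 12`. -/
theorem automorphism_of_A12_is_conjugation
    (φ : alternatingGroup (Fin 12) ≃* alternatingGroup (Fin 12)) :
    ∃ s : Equiv.Perm (Fin 12), ∀ x : alternatingGroup (Fin 12),
      (φ x : Equiv.Perm (Fin 12)) = s * (x : Equiv.Perm (Fin 12)) * s⁻¹ := by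
  have h3 : ∀ k : Fin 12, 2 ≤ k → (threeCycle 0 1 k).IsThreeCycle := fun k hk ↦
    isThreeCycle_threeCycle (by decide) (by grind) (by grind)
  let x : ∀ k : Fin 12, 2 ≤ k → alternatingGroup (Fin 12) := fun k hk ↦
    ⟨threeCycle 0 1 k, (h3 k hk).mem_alternatingGroup⟩
  have rel (t : Perm (Fin 12)) : ∀ (j k : Fin 12) (hj : 2 ≤ j) (hk : 2 ≤ k), j ≠ k →
      ((t * φ (x j hj) * t⁻¹) * (t * φ (x k hk) * t⁻¹)) ^ 2 = 1 ∧
        (t * φ (x j hj) * t⁻¹) * (t * φ (x k hk) * t⁻¹) ≠ 1 := by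
    intro j k hj hk hjk
    obtain ⟨h2, h1⟩ := threeCycle_zero_one_mul j k hj hk hjk
    have e : (t * φ (x j hj) * t⁻¹) * (t * φ (x k hk) * t⁻¹) =
        t * (φ (x j hj * x k hk) : Perm (Fin 12)) * t⁻¹ := by
      rw [map_mul, Subgroup.coe_mul]; group
    have h2' : (x j hj * x k hk) ^ 2 = 1 := Subtype.ext h2
    have h1' : x j hj * x k hk ≠ 1 := fun h ↦ h1 (congrArg Subtype.val h)
    rw [e, conj_pow, ← Subgroup.coe_pow, ← map_pow, h2']
    refine ⟨by simp, ?_⟩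
    rw [Ne, conj_eq_one_iff, OneMemClass.coe_eq_one, EmbeddingLike.map_eq_one_iff]
    exact h1'
  obtain ⟨t, ht2, ht3⟩ := exists_conj_pair
    (isThreeCycle_map φ (g := x 2 (by decide)) (h3 2 (by decide)))
    (isThreeCycle_map φ (g := x 3 (by decide)) (h3 3 (by decide)))
    (by simpa using (rel 1 2 3 (by decide) (by decide) (by decide)).1)
    (by simpa using (rel 1 2 3 (by decide) (by decide) (by decide)).2)
  have ex : ∀ (k : Fin 12) (hk : 2 ≤ k), ∃ d : Fin 12, 2 ≤ d ∧
      t * φ (x k hk) * t⁻¹ = threeCycle 0 1 d := by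
    intro k hk
    by_cases hk2 : k = 2
    · subst hk2; exact ⟨2, by decide, ht2⟩
    by_cases hk3 : k = 3
    · subst hk3; exact ⟨3, by decide, ht3⟩
    have hy : (t * φ (x k hk) * t⁻¹).IsThreeCycle := by
      rw [IsThreeCycle, cycleType_conj]
      exact isThreeCycle_map φ (g := x k hk) (h3 k hk)
    obtain ⟨p, q, r, hpq, hqr, hrp, he⟩ := exists_threeCycle_eq hy
    have r2 := rel t 2 k (by decide) hk (Ne.symm hk2)
    have r3 := rel t 3 k (by decide) hk (Ne.symm hk3)
    rw [ht2, he] at r2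
    rw [ht3, he] at r3
    rw [he]
    exact exists_eq_threeCycle_zero_one p q r hpq hqr hrp r2.1 r2.2 r3.1 r3.2
  choose e he1 he2 using ex
  let f : Fin 12 → Fin 12 := fun k ↦ if hk : 2 ≤ k then e k hk else k
  have hf : Function.Injective f := by
    intro j k h
    by_cases hj : 2 ≤ j <;> by_cases hk : 2 ≤ k
    · simp only [f, hj, hk, dif_pos] at h
      have h' : x j hj = x k hk := by
        have := (he2 j hj).trans ((congrArg (threeCycle 0 1) h).trans (he2 k hk).symm)
        simpa using this
      have h'' : threeCycle 0 1 j = threeCycle 0 1 k := congrArg Subtype.val h'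
      by_contra hjk
      have := congrFun (congrArg DFunLike.coe h'') 1
      have a1 : ∀ i : Fin 12, 2 ≤ i → threeCycle 0 1 i 1 = i := by decide +kernel
      rw [a1 j hj, a1 k hk] at this
      exact hjk this
    · simp only [f, hj, hk, dif_pos, dif_neg, not_false_eq_true] at h
      exact absurd (h ▸ he1 j hj) hk
    · simp only [f, hj, hk, dif_pos, dif_neg, not_false_eq_true] at h
      exact absurd (h.symm ▸ he1 k hk) hj
    · simpa only [f, hj, hk, dif_neg, not_false_eq_true] using h
  let w : Perm (Fin 12) := Equiv.ofBijective f (Finite.injective_iff_bijective.mp hf)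
  refine ⟨t⁻¹ * w, ?_⟩
  let conj : alternatingGroup (Fin 12) →* Perm (Fin 12) :=
    (MulAut.conj (t⁻¹ * w)).toMonoidHom.comp (alternatingGroup (Fin 12)).subtype
  let ψ : alternatingGroup (Fin 12) →* Perm (Fin 12) :=
    (alternatingGroup (Fin 12)).subtype.comp φ.toMonoidHom
  have hle : alternatingGroup (Fin 12) ≤
      (MonoidHom.eqLocus ψ conj).map (alternatingGroup (Fin 12)).subtype := by
    refine alternatingGroup_le_of_threeCycle_zero_one_mem fun k hk ↦ ⟨x k hk, ?_, rfl⟩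
    change (φ (x k hk) : Perm (Fin 12)) = (t⁻¹ * w) * threeCycle 0 1 k * (t⁻¹ * w)⁻¹
    have hw : w * threeCycle 0 1 k * w⁻¹ = threeCycle 0 1 (e k hk) := by
      rw [conj_threeCycle]
      have : w k = e k hk := dif_pos hk
      rw [this]
      rfl
    rw [← he2 k hk] at hw
    calc (φ (x k hk) : Perm (Fin 12)) = t⁻¹ * (t * φ (x k hk) * t⁻¹) * t := by group
      _ = _ := by rw [← hw]; group
  intro g
  obtain ⟨g', hg', hgg⟩ := hle g.2
  obtain rfl : g' = g := Subtype.ext hgg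
  exact hg'
end

section
/- Let H ≤ A₁₁ be any subgroup with exactly 55 elements, and let K ≤ A₁₂ be the subgroup of all even permutations σ of Fin 12 such that σ maps the set {0,1,2} onto itself, maps the set {3,4,…,10} onto itself, and fixes the point 11. Then every group homomorphism f : A₁₁ × A₁₂ → A₁₁ × A₁₂ satisfying f(h, k) = (h, k) for all h ∈ H and k ∈ K is the identity homomorphism. -/
open Equiv Equiv.Perm

section General

theorem MonoidHom.injective_of_apply_ne_one {G G' : Type*} [Group G] [IsSimpleGroup G] [Group G']
    (φ : G →* G') {g : G} (hg : φ g ≠ 1) : Function.Injective φ := by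
  rw [← φ.ker_eq_bot_iff]
  refine (MonoidHom.normal_ker φ).eq_bot_or_eq_top.resolve_right fun h ↦ hg ?_
  rw [← MonoidHom.mem_ker, h]
  trivial

theorem MonoidHom.eq_one_of_apply_eq_one {G G' : Type*} [Group G] [IsSimpleGroup G] [Group G']
    (φ : G →* G') {g : G} (hg : g ≠ 1) (hφ : φ g = 1) : φ = 1 := by
  rw [← MonoidHom.ker_eq_top_iff]
  refine (MonoidHom.normal_ker φ).eq_bot_or_eq_top.resolve_left fun h ↦ hg ?_
  rwa [← MonoidHom.mem_ker, h, Subgroup.mem_bot] at hφ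

variable {α : Type*} [Fintype α] [DecidableEq α]

/-- A three-cycle is determined by the images of a point it moves. -/
theorem Equiv.Perm.IsThreeCycle.exists_eq_swap_mul_swap {g : Perm α} (hg : g.IsThreeCycle)
    {a : α} (ha : g a ≠ a) :
    ∃ b c, a ≠ b ∧ a ≠ c ∧ b ≠ c ∧ g a = b ∧ g b = c ∧ g = swap a b * swap b c := by
  have hs : a ∈ g.support := mem_support.2 ha
  have hn := hg.nodup_iff_mem_support.2 hs
  refine ⟨g a, g (g a), ?_, ?_, ?_, rfl, rfl, hg.eq_swap_mul_swap_iff_mem_support.2 hs⟩ <;>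
  grind

theorem isThreeCycle_swap_mul_swap {a b c : α} (ab : a ≠ b) (ac : a ≠ c) (bc : b ≠ c) :
    (swap a b * swap b c).IsThreeCycle := by
  rw [swap_comm a b]
  exact isThreeCycle_swap_mul_swap_same ab.symm bc ac

/-- The three-cycles through a fixed pair of points generate the alternating group. -/
theorem alternatingGroup_le_of_swap_mul_swap_mem {E : Subgroup (Perm α)} {a b : α}
    (h : ∀ x, x ≠ a → x ≠ b → swap a b * swap b x ∈ E) : alternatingGroup α ≤ E := by
  have star (x : α) (hx : x ≠ b) : swap b a * swap b x ∈ E := by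
    by_cases hxa : x = a
    · simp [hxa, one_mem]
    · simpa [swap_comm b a] using h x hxa hx
  have key (p q : α) (hpq : p ≠ q) : swap b a * swap p q ∈ E := by
    by_cases hp : p = b
    · exact hp ▸ star q (hp ▸ hpq.symm)
    by_cases hq : q = b
    · rw [hq, swap_comm p b]
      exact star p hp
    have hconj : swap p q = swap b p * (swap b q * swap b p) := by
      rw [← mul_assoc, swap_comm b q]
      exact (swap_mul_swap_mul_swap (x := q) (y := b) (z := p) hq (Ne.symm hpq)).symm
    rw [hconj, ← mul_assoc]
    refine E.mul_mem (star p hp) ?_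
    simpa [mul_assoc] using E.mul_mem (E.inv_mem (star q hq)) (star p hp)
  rw [← closure_three_cycles_eq_alternating, Subgroup.closure_le]
  intro g hg
  obtain ⟨p, hp⟩ : ∃ p, g p ≠ p := by
    by_contra! hg1
    exact IsThreeCycle.ne_one hg (Equiv.ext hg1)
  obtain ⟨q, s, hpq, -, hqs, -, -, rfl⟩ := IsThreeCycle.exists_eq_swap_mul_swap hg hp
  simpa [mul_assoc] using E.mul_mem (E.inv_mem (key p q hpq)) (key q s hqs)

/-- In prime degree a full cycle and a three-cycle generate a group containing the
alternating group. -/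
theorem alternatingGroup_le_of_isCycle_mem_of_isThreeCycle_mem {E : Subgroup (Perm α)}
    (hp : (Nat.card α).Prime) {c t : Perm α} (hc : c.IsCycle) (hsupp : ∀ x, c x ≠ x)
    (hcE : c ∈ E) (ht : t.IsThreeCycle) (htE : t ∈ E) : alternatingGroup α ≤ E := by
  have : MulAction.IsPretransitive E α := ⟨fun x y ↦ by
    obtain ⟨i, hi⟩ := hc.exists_zpow_eq (hsupp x) (hsupp y)
    exact ⟨⟨c ^ i, E.zpow_mem hcE i⟩, hi⟩⟩
  exact alternatingGroup_le_of_isPreprimitive_of_isThreeCycle_mem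
    (MulAction.IsPreprimitive.of_prime_card hp) ht htE

theorem alternatingGroup.isThreeCycle_map {φ : alternatingGroup α →* alternatingGroup α}
    (h5 : 5 ≤ Nat.card α) {s t : alternatingGroup α} (hs : (s : Perm α).IsThreeCycle)
    (ht : (t : Perm α).IsThreeCycle) (hφ : (φ s : Perm α).IsThreeCycle) :
    (φ t : Perm α).IsThreeCycle := by
  obtain ⟨g, rfl⟩ := isConj_iff.1 (alternatingGroup.isThreeCycle_isConj h5 hs ht)
  simpa [IsThreeCycle, cycleType_conj] using hφ

/-- An endomorphism of an alternating group is conjugation by `s` as soon as the subgroup on which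
the two agree is everything. -/
theorem alternatingGroup.map_eq_conj_of_le {φ : alternatingGroup α →* alternatingGroup α}
    {s : Perm α}
    (h : alternatingGroup α ≤
      (φ.eqLocus (MulAut.conjNormal s).toMonoidHom).map (alternatingGroup α).subtype)
    (g : alternatingGroup α) : (φ g : Perm α) = s * g * s⁻¹ := by
  obtain ⟨g', hg', hgg'⟩ := h g.2
  obtain rfl : g' = g := Subtype.ext hgg'
  rw [← MulAut.conjNormal_apply]
  exact congrArg Subtype.val hg'

end General

section Degree11

theorem isThreeCycle_of_commute_orderOf_seven {u y : Perm (Fin 11)} (hu : orderOf u = 3)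
    (hy : orderOf y = 7) (h : Commute u y) : u.IsThreeCycle := by
  obtain ⟨n, hn⟩ := cycleType_prime_order (σ := u) (hu ▸ Nat.prime_three)
  have hdvd : 7 ∣ Nat.card (Subgroup.centralizer {u}) := by
    have hmem : y ∈ Subgroup.centralizer {u} :=
      Subgroup.mem_centralizer_singleton_iff.2 h.symm
    rw [← hy]
    exact Subgroup.orderOf_dvd_natCard _ hmem
  have hsum := sum_cycleType_le u
  rw [nat_card_centralizer] at hdvd
  rw [hn, hu] at hdvd hsum
  simp only [Multiset.sum_replicate, smul_eq_mul, Fintype.card_fin] at hsum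
  have hn2 : n ≤ 2 := by lia
  interval_cases n
  · rw [IsThreeCycle, hn, hu]
    rfl
  · exact absurd hdvd (by decide +kernel)
  · exact absurd hdvd (by decide +kernel)

theorem orderOf_addRight_one : orderOf (Equiv.addRight 1 : Perm (Fin 11)) = 11 :=
  have : Fact (Nat.Prime 11) := ⟨by norm_num⟩
  orderOf_eq_prime (by decide +kernel) (by decide +kernel)

theorem cycleType_of_orderOf_eleven {c : Perm (Fin 11)} (hc : orderOf c = 11) :
    c.cycleType = {11} := by
  obtain ⟨n, hn⟩ := cycleType_prime_order (σ := c) (by rw [hc]; norm_num)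
  have hsum := sum_cycleType_le c
  rw [hn, hc] at hsum
  simp only [Multiset.sum_replicate, smul_eq_mul, Fintype.card_fin] at hsum
  obtain rfl : n = 0 := by lia
  rw [hn, hc]
  rfl

theorem commute_addRight (i j : Fin 11) :
    Commute (Equiv.addRight i : Perm (Fin 11)) (Equiv.addRight j) :=
  Equiv.ext fun x ↦ add_right_comm x j i

theorem addRight_eq_pow :
    ∀ i : Fin 11, (Equiv.addRight i : Perm (Fin 11)) = Equiv.addRight 1 ^ (i : ℕ) := by
  decide +kernel

theorem addRight_mem_zpowers (i : Fin 11) :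
    (Equiv.addRight i : Perm (Fin 11)) ∈ Subgroup.zpowers (Equiv.addRight 1 : Perm (Fin 11)) := by
  rw [addRight_eq_pow i]
  exact Subgroup.npow_mem_zpowers (Equiv.addRight 1 : Perm (Fin 11)) i

theorem three_cycle_eq_translate : ∀ a b : Fin 11, 0 ≠ a → 0 ≠ b → a ≠ b →
    (∀ i ∈ ([3, 4, 5] : List (Fin 11)), Commute (swap 0 a * swap a b)
      (Equiv.addRight i * (swap 0 a * swap a b) * (Equiv.addRight i)⁻¹)) →
    (Equiv.addRight 1 * (swap 0 a * swap a b)) ^ 11 = 1 →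
    ∃ j : Fin 11, (swap 0 a * swap a b : Perm (Fin 11)) =
      Equiv.addRight j * (swap 0 1 * swap 1 2) * (Equiv.addRight j)⁻¹ := by
  unfold Commute SemiconjBy
  decide +kernel

theorem isThreeCycle_zero_one_two :
    (swap 0 1 * swap 1 2 : Perm (Fin 11)).IsThreeCycle :=
  isThreeCycle_swap_mul_swap (by decide) (by decide) (by decide)

theorem isThreeCycle_map_zero_one_two {φ : alternatingGroup (Fin 11) →* alternatingGroup (Fin 11)}
    (hφ : Function.Injective φ) {t : alternatingGroup (Fin 11)}
    (ht : (t : Perm (Fin 11)) = swap 0 1 * swap 1 2) : (φ t : Perm (Fin 11)).IsThreeCycle := by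
  let y : alternatingGroup (Fin 11) :=
    ⟨([3, 4, 5, 6, 7, 8, 9] : List (Fin 11)).formPerm,
      mem_alternatingGroup.2 (by decide +kernel)⟩
  have : Fact (Nat.Prime 7) := ⟨by norm_num⟩
  have hy : orderOf y = 7 := orderOf_eq_prime (by decide +kernel) (by decide +kernel)
  have hty : Commute t y := Subtype.ext (by
    rw [Subgroup.coe_mul, Subgroup.coe_mul, ht]
    decide +kernel)
  refine isThreeCycle_of_commute_orderOf_seven (y := φ y) ?_ ?_ ?_
  · rw [Subgroup.orderOf_coe, orderOf_injective φ hφ, ← Subgroup.orderOf_coe, ht]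
    exact isThreeCycle_zero_one_two.orderOf
  · rw [Subgroup.orderOf_coe, orderOf_injective φ hφ, hy]
  · exact (hty.map φ).map (alternatingGroup (Fin 11)).subtype

/-- An injective endomorphism of `A₁₁` fixing the rotation is conjugation by a translation, provided
the image of `(0 1 2)` moves `0`. -/
theorem eq_conj_addRight_of_apply_zero_ne
    {φ : alternatingGroup (Fin 11) →* alternatingGroup (Fin 11)}
    (hφ : Function.Injective φ) {r t : alternatingGroup (Fin 11)}
    (hr : (r : Perm (Fin 11)) = Equiv.addRight 1) (hφr : φ r = r)
    (ht : (t : Perm (Fin 11)) = swap 0 1 * swap 1 2) (h0 : (φ t : Perm (Fin 11)) 0 ≠ 0) :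
    ∃ j : Fin 11, ∀ g, (φ g : Perm (Fin 11)) =
      Equiv.addRight j * g * (Equiv.addRight j)⁻¹ := by
  obtain ⟨a, b, ha, hb, hab, -, -, hu⟩ :=
    (isThreeCycle_map_zero_one_two hφ ht).exists_eq_swap_mul_swap h0
  obtain ⟨j, hj⟩ := three_cycle_eq_translate a b ha hb hab
    (fun i hi ↦ by
      have hc : Commute t (r ^ (i : ℕ) * t * (r ^ (i : ℕ))⁻¹) := Subtype.ext (by
        simp only [Subgroup.coe_mul, Subgroup.coe_inv, Subgroup.coe_pow, hr, ht, ← addRight_eq_pow]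
        revert i
        decide +kernel)
      have := (hc.map φ).map (alternatingGroup (Fin 11)).subtype
      simpa only [map_mul, map_inv, map_pow, hφr, Subgroup.subtype_apply, hr, hu, ← addRight_eq_pow]
        using this)
    (by
      have hc : (r * t) ^ 11 = 1 := Subtype.ext (by
        rw [Subgroup.coe_pow, Subgroup.coe_mul, hr, ht]
        decide +kernel)
      have := congrArg (fun g ↦ (φ g : Perm (Fin 11))) hc
      simpa only [map_mul, map_pow, hφr, Subgroup.coe_mul, Subgroup.coe_pow, hr, hu, map_one,
        Subgroup.coe_one] using this)
  refine ⟨j, alternatingGroup.map_eq_conj_of_le ?_⟩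
  refine alternatingGroup_le_of_isCycle_mem_of_isThreeCycle_mem (c := r) (t := t)
    (by rw [Nat.card_fin]; norm_num) ?_ ?_ ⟨r, ?_, rfl⟩ ?_ ⟨t, ?_, rfl⟩
  · rw [hr, ← card_cycleType_eq_one, cycleType_of_orderOf_eleven orderOf_addRight_one,
      Multiset.card_singleton]
  · rw [hr]
    decide
  · refine Subtype.ext ?_
    rw [hφr]
    change (r : Perm (Fin 11)) = ((MulAut.conjNormal (Equiv.addRight j) r :) : Perm (Fin 11))
    rw [MulAut.conjNormal_apply, hr, (commute_addRight j 1).eq, mul_inv_cancel_right]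
  · rw [ht]
    exact isThreeCycle_zero_one_two
  · refine Subtype.ext ?_
    change _ = ((MulAut.conjNormal (Equiv.addRight j) t :) : Perm (Fin 11))
    rw [MulAut.conjNormal_apply, hu, hj, ht]

theorem eq_conj_addRight {φ : alternatingGroup (Fin 11) →* alternatingGroup (Fin 11)}
    (hφ : Function.Injective φ) {r : alternatingGroup (Fin 11)}
    (hr : (r : Perm (Fin 11)) = Equiv.addRight 1) (hφr : φ r = r) :
    ∃ j : Fin 11, ∀ g, (φ g : Perm (Fin 11)) =
      Equiv.addRight j * g * (Equiv.addRight j)⁻¹ := by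
  let t : alternatingGroup (Fin 11) :=
    ⟨swap 0 1 * swap 1 2, isThreeCycle_zero_one_two.mem_alternatingGroup⟩
  obtain ⟨p, hp⟩ : ∃ p, (φ t : Perm (Fin 11)) p ≠ p := by
    by_contra! h
    exact (isThreeCycle_map_zero_one_two hφ (t := t) rfl).ne_one (Equiv.ext h)
  have hψ (g : alternatingGroup (Fin 11)) :
      (((MulAut.conjNormal (Equiv.addRight p)⁻¹).toMonoidHom.comp φ g :) : Perm (Fin 11)) =
        (Equiv.addRight p)⁻¹ * φ g * Equiv.addRight p := by
    change ((MulAut.conjNormal (Equiv.addRight p)⁻¹ (φ g) :) : Perm (Fin 11)) = _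
    rw [MulAut.conjNormal_apply, inv_inv]
  obtain ⟨j, hj⟩ := eq_conj_addRight_of_apply_zero_ne
    (φ := (MulAut.conjNormal (Equiv.addRight p)⁻¹).toMonoidHom.comp φ)
    ((MulEquiv.injective _).comp hφ) hr
    (Subtype.ext (by
      rw [hψ, hφr, hr, mul_assoc, (commute_addRight 1 p).eq, inv_mul_cancel_left]))
    (t := t) rfl (by
      rw [hψ]
      intro h
      rw [mul_assoc, mul_apply, inv_eq_iff_eq] at h
      exact hp (by simpa using h))
  refine ⟨j + p, fun g ↦ ?_⟩
  have hjp : (Equiv.addRight (j + p) : Perm (Fin 11)) = Equiv.addRight p * Equiv.addRight j :=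
    Equiv.ext fun x ↦ (add_assoc x j p).symm
  have := hj g
  rw [hψ] at this
  rw [hjp, mul_inv_rev]
  have h2 : (φ g : Perm (Fin 11)) = Equiv.addRight p *
    ((Equiv.addRight p)⁻¹ * φ g * Equiv.addRight p) * (Equiv.addRight p)⁻¹ := by group
  rw [h2, this]
  group

/-- An injective endomorphism of `A₁₁` fixing an element of order `11` is conjugation by a power of
this element. -/
theorem exists_mem_zpowers_eq_conj {φ : alternatingGroup (Fin 11) →* alternatingGroup (Fin 11)}
    (hφ : Function.Injective φ) {c : alternatingGroup (Fin 11)} (hc : orderOf c = 11)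
    (hφc : φ c = c) :
    ∃ s ∈ Subgroup.zpowers (c : Perm (Fin 11)), ∀ g, (φ g : Perm (Fin 11)) = s * g * s⁻¹ := by
  rw [← Subgroup.orderOf_coe] at hc
  obtain ⟨σ, hσ⟩ := isConj_iff.1 (isConj_iff_cycleType_eq.2
    ((cycleType_of_orderOf_eleven hc).trans
      (cycleType_of_orderOf_eleven orderOf_addRight_one).symm))
  let κ : MulAut (alternatingGroup (Fin 11)) := MulAut.conjNormal σ
  have hκ (g) : (κ g : Perm (Fin 11)) = σ * g * σ⁻¹ := MulAut.conjNormal_apply σ g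
  obtain ⟨j, hj⟩ := eq_conj_addRight (φ := κ.toMonoidHom.comp (φ.comp κ.symm.toMonoidHom))
    (r := κ c) (κ.injective.comp (hφ.comp κ.symm.injective)) ((hκ c).trans hσ)
    (by simp [hφc])
  refine ⟨σ⁻¹ * Equiv.addRight j * σ, ?_, fun g ↦ ?_⟩
  · obtain ⟨n, hn⟩ := addRight_mem_zpowers j
    refine ⟨n, ?_⟩
    dsimp only at hn ⊢
    rw [← hn, ← hσ, conj_zpow]
    group
  · have := hj (κ g)
    simp only [MonoidHom.comp_apply, MulEquiv.toMonoidHom_eq_coe, MonoidHom.coe_coe,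
      MulEquiv.symm_apply_apply, hκ] at this
    have h2 : (φ g : Perm (Fin 11)) = σ⁻¹ * (σ * φ g * σ⁻¹) * σ := by group
    rw [h2, this]
    group

theorem eq_id_of_fixes_of_card_eq_55 {H : Subgroup (alternatingGroup (Fin 11))}
    (hH : Nat.card H = 55) {φ : alternatingGroup (Fin 11) →* alternatingGroup (Fin 11)}
    (hφ : Function.Injective φ) (hfix : ∀ h ∈ H, φ h = h) :
    φ = MonoidHom.id _ := by
  have : Fact (Nat.Prime 11) := ⟨by norm_num⟩
  obtain ⟨⟨c, hcH⟩, hc⟩ := exists_prime_orderOf_dvd_card' (G := H) 11 (by rw [hH]; norm_num)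
  rw [Subgroup.orderOf_mk] at hc
  obtain ⟨s, hs, hconj⟩ := exists_mem_zpowers_eq_conj hφ hc (hfix c hcH)
  suffices hs1 : s = 1 by
    ext1 g
    exact Subtype.ext (by simpa [hs1] using hconj g)
  by_contra hs1
  have hord : orderOf s = 11 := by
    have hdvd := orderOf_dvd_of_mem_zpowers hs
    rw [Subgroup.orderOf_coe, hc] at hdvd
    exact ((Nat.dvd_prime (by norm_num)).1 hdvd).resolve_left (mt orderOf_eq_one_iff.1 hs1)
  have hcard : Nat.card (Subgroup.centralizer {s}) = 11 := by
    rw [nat_card_centralizer, cycleType_of_orderOf_eleven hord]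
    decide +kernel
  have hle : H.map (alternatingGroup (Fin 11)).subtype ≤ Subgroup.centralizer {s} := by
    rintro _ ⟨h, hh, rfl⟩
    have := hconj h
    rw [hfix h hh, eq_mul_inv_iff_mul_eq] at this
    exact Subgroup.mem_centralizer_singleton_iff.2 this
  have hdvd := Subgroup.card_dvd_of_le hle
  rw [hcard, Subgroup.card_map_of_injective (Subgroup.subtype_injective _), hH] at hdvd
  exact absurd hdvd (by norm_num)

end Degree11

section Degree12

theorem apply_three_of_mul_sq_eq_one : ∀ p ∈ ([3, 4, 5] : List (Fin 12)), ∀ q s : Fin 12,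
    p ≠ q → p ≠ s → q ≠ s →
    ((swap p q * swap q s) * (swap 3 4 * swap 4 5)) ^ 2 = 1 →
    Commute (swap 5 6 * swap 6 7) (swap p q * swap q s) →
    (swap p q * swap q s) 3 = 4 := by
  unfold Commute SemiconjBy
  decide +kernel

/-- Some even permutations preserving `{0, 1, 2}` and `{3, …, 10}` and fixing `3`, `4`, `11`. -/
def partitionPerms : List (Perm (Fin 12)) :=
  [swap 5 6 * swap 6 7, swap 8 9 * swap 9 10, swap 0 1 * swap 1 2, swap 0 1 * swap 5 6,
    swap 0 2 * swap 5 6, swap 1 2 * swap 5 6]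

theorem mem_alternatingGroup_of_mem_partitionPerms {g : Perm (Fin 12)} (hg : g ∈ partitionPerms) :
    g ∈ alternatingGroup (Fin 12) := by
  simp only [partitionPerms, List.mem_cons, List.not_mem_nil, or_false] at hg
  rcases hg with rfl | rfl | rfl | rfl | rfl | rfl <;>
  simp [mem_alternatingGroup, sign_swap']

theorem preserves_of_mem_partitionPerms {g : Perm (Fin 12)} (hg : g ∈ partitionPerms) :
    (∀ x ∈ ({0, 1, 2} : Finset (Fin 12)), g x ∈ ({0, 1, 2} : Finset (Fin 12))) ∧
    (∀ x ∈ ({3, 4, 5, 6, 7, 8, 9, 10} : Finset (Fin 12)),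
      g x ∈ ({3, 4, 5, 6, 7, 8, 9, 10} : Finset (Fin 12))) ∧
    g 11 = 11 ∧ g 3 = 3 ∧ g 4 = 4 := by
  simp only [partitionPerms, List.mem_cons, List.not_mem_nil, or_false] at hg
  rcases hg with rfl | rfl | rfl | rfl | rfl | rfl <;> decide +kernel

theorem exists_fixing_and_moving : ∀ x ∈ ([0, 1, 2, 11] : List (Fin 12)), ∀ s : Fin 12,
    s ≠ 3 → s ≠ 4 → s ≠ x → s ≠ 11 →
    ∃ g ∈ partitionPerms, g x = x ∧ g s ≠ s := by
  decide +kernel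

/-- The images of the three-cycles `(3 4 x)`, for `x` outside `{3, …, 10}`, are pinned down by their
relation to `(3 4 5)` and by commuting with the members of `partitionPerms` that fix `x`. -/
theorem eq_id_of_fixes_partition_stabilizer
    {φ : alternatingGroup (Fin 12) →* alternatingGroup (Fin 12)} (hφ : Function.Injective φ)
    (hfix : ∀ σ : alternatingGroup (Fin 12),
      (∀ x ∈ ({0, 1, 2} : Finset (Fin 12)),
        (σ : Perm (Fin 12)) x ∈ ({0, 1, 2} : Finset (Fin 12))) →
      (∀ x ∈ ({3, 4, 5, 6, 7, 8, 9, 10} : Finset (Fin 12)),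
        (σ : Perm (Fin 12)) x ∈ ({3, 4, 5, 6, 7, 8, 9, 10} : Finset (Fin 12))) →
      (σ : Perm (Fin 12)) 11 = 11 → φ σ = σ) :
    φ = MonoidHom.id _ := by
  have h34 (x : Fin 12) (h3 : x ≠ 3) (h4 : x ≠ 4) :
      (swap 3 4 * swap 4 x : Perm (Fin 12)).IsThreeCycle :=
    isThreeCycle_swap_mul_swap (by decide) h3.symm h4.symm
  let τ (x : Fin 12) (h3 : x ≠ 3) (h4 : x ≠ 4) : alternatingGroup (Fin 12) :=
    ⟨swap 3 4 * swap 4 x, (h34 x h3 h4).mem_alternatingGroup⟩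
  have hτfix : ∀ x (h3 : x ≠ 3) (h4 : x ≠ 4), x ∈ ([5, 6, 7, 8, 9, 10] : List (Fin 12)) →
      φ (τ x h3 h4) = τ x h3 h4 := by
    intro x h3 h4 hx
    have hx' : ∀ x ∈ ([5, 6, 7, 8, 9, 10] : List (Fin 12)),
        (∀ y ∈ ({0, 1, 2} : Finset (Fin 12)),
          (swap 3 4 * swap 4 x : Perm (Fin 12)) y ∈ ({0, 1, 2} : Finset (Fin 12))) ∧
        (∀ y ∈ ({3, 4, 5, 6, 7, 8, 9, 10} : Finset (Fin 12)),
          (swap 3 4 * swap 4 x : Perm (Fin 12)) y ∈ ({3, 4, 5, 6, 7, 8, 9, 10} : Finset (Fin 12))) ∧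
        (swap 3 4 * swap 4 x : Perm (Fin 12)) 11 = 11 := by
      decide +kernel
    exact hfix _ (hx' x hx).1 (hx' x hx).2.1 (hx' x hx).2.2
  have hτ5 : φ (τ 5 (by decide) (by decide)) = τ 5 (by decide) (by decide) :=
    hτfix 5 (by decide) (by decide) (by decide)
  have hlist : ∀ g ∈ partitionPerms,
      g 3 = 3 ∧ g 4 = 4 ∧ ∃ hg : g ∈ alternatingGroup (Fin 12), φ ⟨g, hg⟩ = ⟨g, hg⟩ := by
    intro g hg
    obtain ⟨h1, h2, h3, h4, h5⟩ := preserves_of_mem_partitionPerms hg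
    exact ⟨h4, h5, mem_alternatingGroup_of_mem_partitionPerms hg, hfix _ h1 h2 h3⟩
  have hcomm (x : Fin 12) (h3 : x ≠ 3) (h4 : x ≠ 4) : ∀ g ∈ partitionPerms, g x = x →
      Commute g (φ (τ x h3 h4) : Perm (Fin 12)) := by
    intro g hg hx
    obtain ⟨hg3, hg4, hgA, hgφ⟩ := hlist g hg
    have hc : Commute (⟨g, hgA⟩ : alternatingGroup (Fin 12)) (τ x h3 h4) := Subtype.ext (by
      change g * (swap 3 4 * swap 4 x) = (swap 3 4 * swap 4 x) * g
      rw [← mul_assoc, mul_swap_eq_swap_mul g 3 4, mul_assoc, mul_swap_eq_swap_mul g 4 x, hg3, hg4,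
        hx, mul_assoc])
    have := (hc.map φ).map (alternatingGroup (Fin 12)).subtype
    rwa [hgφ] at this
  have houter : ∀ x (h3 : x ≠ 3) (h4 : x ≠ 4), x ∈ ([0, 1, 2, 11] : List (Fin 12)) →
      φ (τ x h3 h4) = τ x h3 h4 ∨ φ (τ x h3 h4) = τ 11 (by decide) (by decide) := by
    intro x h3 h4 hx
    have hthree : (φ (τ x h3 h4) : Perm (Fin 12)).IsThreeCycle :=
      alternatingGroup.isThreeCycle_map (by simp) (s := τ 5 (by decide) (by decide))
        (h34 5 (by decide) (by decide)) (h34 x h3 h4) (by rw [hτ5]; exact h34 5 (by decide) (by decide))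
    have hsq : ((φ (τ x h3 h4) : Perm (Fin 12)) * (swap 3 4 * swap 4 5)) ^ 2 = 1 := by
      have h : (τ x h3 h4 * τ 5 (by decide) (by decide)) ^ 2 = 1 := Subtype.ext (by
        have h : ∀ x ∈ ([0, 1, 2, 11] : List (Fin 12)),
            ((swap 3 4 * swap 4 x) * (swap 3 4 * swap 4 5) : Perm (Fin 12)) ^ 2 = 1 := by
          decide +kernel
        exact h x hx)
      have := congrArg (fun g ↦ (φ g : Perm (Fin 12))) h
      simpa only [map_mul, map_pow, hτ5, Subgroup.coe_mul, Subgroup.coe_pow, map_one,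
        Subgroup.coe_one] using this
    have hφ3 : (φ (τ x h3 h4) : Perm (Fin 12)) 3 = 4 := by
      obtain ⟨p, hp, hup⟩ : ∃ p ∈ ([3, 4, 5] : List (Fin 12)),
          (φ (τ x h3 h4) : Perm (Fin 12)) p ≠ p := by
        by_contra! h
        have e := Equiv.congr_fun hsq 3
        have e4 := h 4 (by decide)
        have e5 := h 5 (by decide)
        have s3 : (swap 3 4 * swap 4 5 : Perm (Fin 12)) 3 = 4 := by decide +kernel
        have s4 : (swap 3 4 * swap 4 5 : Perm (Fin 12)) 4 = 5 := by decide +kernel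
        change (φ (τ x h3 h4) : Perm (Fin 12)) ((swap 3 4 * swap 4 5 : Perm (Fin 12))
          ((φ (τ x h3 h4) : Perm (Fin 12)) ((swap 3 4 * swap 4 5 : Perm (Fin 12)) 3))) = 3 at e
        rw [s3, e4, s4, e5] at e
        exact absurd e (by decide)
      obtain ⟨q, s, hpq, hps, hqs, -, -, hu⟩ := hthree.exists_eq_swap_mul_swap hup
      have hfixed : ∀ x ∈ ([0, 1, 2, 11] : List (Fin 12)),
          (swap 5 6 * swap 6 7 : Perm (Fin 12)) x = x := by decide +kernel
      have hc := hcomm x h3 h4 (swap 5 6 * swap 6 7) (by simp [partitionPerms]) (hfixed x hx)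
      rw [hu] at hsq hc ⊢
      exact apply_three_of_mul_sq_eq_one p hp q s hpq hps hqs hsq hc
    obtain ⟨q, s, -, h3s, hqs, hq, hs, hu⟩ :=
      hthree.exists_eq_swap_mul_swap (a := 3) (by rw [hφ3]; decide)
    obtain rfl : q = 4 := hq.symm.trans hφ3
    have : s = x ∨ s = 11 := by
      by_contra! hs'
      obtain ⟨g, hg, hgx, hgs⟩ :=
        exists_fixing_and_moving x hx s h3s.symm hqs.symm hs'.1 hs'.2
      have h := Equiv.congr_fun (hcomm x h3 h4 g hg hgx).eq 4
      rw [mul_apply, mul_apply, (hlist g hg).2.1, hs] at h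
      exact hgs h
    refine this.imp (fun h ↦ Subtype.ext ?_) fun h ↦ Subtype.ext ?_
    · rw [hu, h]
    · rw [hu, h]
  have hall : ∀ x (h3 : x ≠ 3) (h4 : x ≠ 4), φ (τ x h3 h4) = τ x h3 h4 := by
    intro x h3 h4
    have hx : ∀ x : Fin 12, x ≠ 3 → x ≠ 4 → x ∈ ([5, 6, 7, 8, 9, 10] : List (Fin 12)) ∨
      x ∈ ([0, 1, 2, 11] : List (Fin 12)) := by decide
    refine (hx x h3 h4).elim (hτfix x h3 h4) fun hx ↦ (houter x h3 h4 hx).elim id fun h ↦ ?_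
    have h11 : φ (τ 11 (by decide) (by decide)) = τ 11 (by decide) (by decide) :=
      (houter 11 (by decide) (by decide) (by decide)).elim id id
    rwa [← hφ (h.trans h11.symm)] at h
  ext1 g
  have hle : alternatingGroup (Fin 12) ≤
      (φ.eqLocus (MonoidHom.id _)).map (alternatingGroup (Fin 12)).subtype :=
    alternatingGroup_le_of_swap_mul_swap_mem (a := 3) (b := 4) fun x h3 h4 ↦
      ⟨τ x h3 h4, hall x h3 h4, rfl⟩
  obtain ⟨g', hg', hgg'⟩ := hle g.2
  obtain rfl : g' = g := Subtype.ext hgg'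
  exact hg'

end Degree12

theorem Equiv.Perm.image_coe_finset_eq {α : Type*} (σ : Perm α) {s : Finset α}
    (h : ∀ x ∈ s, σ x ∈ s) : σ '' (s : Set α) = s :=
  Set.eq_of_subset_of_ncard_le (Set.image_subset_iff.2 h)
    (Set.ncard_image_of_injective _ σ.injective).ge

/-- Let `H ≤ A₁₁` have exactly `55` elements and let `K ≤ A₁₂` consist of the even
permutations of `Fin 12` preserving `{0,1,2}`, preserving `{3,…,10}` and fixing `11`.
Any endomorphism of `A₁₁ × A₁₂` which is the identity on `H × K` is the identity. -/
theorem endo_of_A11_times_A12_fixing_HK_is_id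
    (H : Subgroup (alternatingGroup (Fin 11))) (hH : Nat.card H = 55)
    (K : Subgroup (alternatingGroup (Fin 12)))
    (hK : ∀ σ : alternatingGroup (Fin 12), σ ∈ K ↔
      ((σ : Equiv.Perm (Fin 12)) '' ({0, 1, 2} : Set (Fin 12)) = {0, 1, 2} ∧
        (σ : Equiv.Perm (Fin 12)) '' ({3, 4, 5, 6, 7, 8, 9, 10} : Set (Fin 12)) =
          {3, 4, 5, 6, 7, 8, 9, 10} ∧
        (σ : Equiv.Perm (Fin 12)) (11 : Fin 12) = (11 : Fin 12)))
    (f : alternatingGroup (Fin 11) × alternatingGroup (Fin 12) →*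
      alternatingGroup (Fin 11) × alternatingGroup (Fin 12))
    (hf : ∀ h ∈ H, ∀ k ∈ K, f (h, k) = (h, k)) :
    f = MonoidHom.id (alternatingGroup (Fin 11) × alternatingGroup (Fin 12)) := by
  have hfixK : ∀ σ : alternatingGroup (Fin 12),
      (∀ x ∈ ({0, 1, 2} : Finset (Fin 12)),
        (σ : Perm (Fin 12)) x ∈ ({0, 1, 2} : Finset (Fin 12))) →
      (∀ x ∈ ({3, 4, 5, 6, 7, 8, 9, 10} : Finset (Fin 12)),
        (σ : Perm (Fin 12)) x ∈ ({3, 4, 5, 6, 7, 8, 9, 10} : Finset (Fin 12))) →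
      (σ : Perm (Fin 12)) 11 = 11 → σ ∈ K := fun σ h1 h2 h3 ↦
    (hK σ).2 ⟨by simpa using image_coe_finset_eq _ h1, by simpa using image_coe_finset_eq _ h2, h3⟩
  have : IsSimpleGroup (alternatingGroup (Fin 11)) := alternatingGroup.isSimpleGroup (by simp)
  have : IsSimpleGroup (alternatingGroup (Fin 12)) := alternatingGroup.isSimpleGroup (by simp)
  obtain ⟨⟨h, hh⟩, hne⟩ : ∃ h : H, h ≠ 1 := by
    have := Finite.one_lt_card_iff_nontrivial.1 (hH ▸ (by norm_num : 1 < 55))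
    exact exists_ne 1
  replace hne : h ≠ 1 := fun h1 ↦ hne (Subtype.ext h1)
  obtain ⟨k, hk, hkne⟩ : ∃ k ∈ K, k ≠ 1 := by
    refine ⟨⟨swap 0 1 * swap 1 2, mem_alternatingGroup.2 (by decide +kernel)⟩, hfixK _ ?_ ?_ ?_, ?_⟩
    all_goals decide +kernel
  have hfH (h) (hh : h ∈ H) : f (h, 1) = (h, 1) := hf h hh 1 K.one_mem
  have hfK (k) (hk : k ∈ K) : f (1, k) = (1, k) := hf 1 H.one_mem k hk
  let ι₁ := MonoidHom.inl (alternatingGroup (Fin 11)) (alternatingGroup (Fin 12))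
  let ι₂ := MonoidHom.inr (alternatingGroup (Fin 11)) (alternatingGroup (Fin 12))
  let π₁ := MonoidHom.fst (alternatingGroup (Fin 11)) (alternatingGroup (Fin 12))
  let π₂ := MonoidHom.snd (alternatingGroup (Fin 11)) (alternatingGroup (Fin 12))
  have h₁₁ : π₁.comp (f.comp ι₁) = MonoidHom.id _ :=
    eq_id_of_fixes_of_card_eq_55 hH
      (MonoidHom.injective_of_apply_ne_one _ (g := h)
        (by simpa [π₁, ι₁, hfH h hh] using hne))
      fun h hh ↦ by simp [π₁, ι₁, hfH h hh]
  have h₂₁ : π₂.comp (f.comp ι₁) = 1 :=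
    MonoidHom.eq_one_of_apply_eq_one _ hne (by simp [π₂, ι₁, hfH h hh])
  have h₁₂ : π₁.comp (f.comp ι₂) = 1 :=
    MonoidHom.eq_one_of_apply_eq_one _ hkne (by simp [π₁, ι₂, hfK k hk])
  have h₂₂ : π₂.comp (f.comp ι₂) = MonoidHom.id _ :=
    eq_id_of_fixes_partition_stabilizer
      (MonoidHom.injective_of_apply_ne_one _ (g := k)
        (by simpa [π₂, ι₂, hfK k hk] using hkne))
      fun σ h1 h2 h3 ↦ by simp [π₂, ι₂, hfK σ (hfixK σ h1 h2 h3)]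
  have hinl : f.comp ι₁ = ι₁ := MonoidHom.ext fun g ↦
    Prod.ext (DFunLike.congr_fun h₁₁ g) (DFunLike.congr_fun h₂₁ g)
  have hinr : f.comp ι₂ = ι₂ := MonoidHom.ext fun g ↦
    Prod.ext (DFunLike.congr_fun h₁₂ g) (DFunLike.congr_fun h₂₂ g)
  refine MonoidHom.ext fun g ↦ ?_
  have hg : g = ι₁ g.1 * ι₂ g.2 := by simp [ι₁, ι₂]
  rw [hg, map_mul, map_mul]
  exact congrArg₂ (· * ·) (DFunLike.congr_fun hinl g.1) (DFunLike.congr_fun hinr g.2)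
end
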